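/- arXiv:2505.09775 — 9 statements merged into one kernel-verified Lean document; each statement's English description precedes it below -/
import Mathlib

section
/- There is no rational number r such that for all sufficiently large primes p the image of r in ZMod p equals the Legendre symbol (2/p) (viewed in ZMod p). In other words, the element ((2/p))_p of the poor man's adèle ring is irrational. -/
/-- A congruence `n / d ≡ c` modulo a prime exceeding `d` and `|n - c * d|` is an equality. -/
theorem eq_mul_of_zmod_eq {p d : ℕ} {n c : ℤ} [Fact p.Prime] (hd : 0 < d) (hdp : d < p)
    (hn : (n - c * d).natAbs < p) (h : (n : ZMod p) * (d : ZMod p)⁻¹ = (c : ZMod p)) :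
    n = c * d := by
  have hd' : (d : ZMod p) ≠ 0 := by
    rw [Ne, ZMod.natCast_eq_zero_iff]
    exact Nat.not_dvd_of_pos_of_lt hd hdp
  have hz : ((n - c * d : ℤ) : ZMod p) = 0 := by
    push_cast
    rw [← h, inv_mul_cancel_right₀ hd', sub_self]
  rw [ZMod.intCast_zmod_eq_zero_iff_dvd] at hz
  exact sub_eq_zero.1 (Int.eq_zero_of_dvd_of_natAbs_lt_natAbs hz hn)


/-- There is no rational number `r` whose image in `ZMod p` equals the Legendre symbol
`(2/p)` for all sufficiently large primes `p`: the element `((2/p))_p` of the poor man's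
adèle ring is irrational. -/
theorem legendre_two_irrational :
    ¬ ∃ (r : ℚ) (N : ℕ), ∀ (p : ℕ) (hp : p.Prime), N ≤ p →
      (r.num : ZMod p) * (r.den : ZMod p)⁻¹ = ((@legendreSym p ⟨hp⟩ 2 : ℤ) : ZMod p) := by
  rintro ⟨r, N, h⟩
  have key (a : ℕ) (ha : a.Coprime 8) (c : ℤ) (hc : ZMod.χ₈ (a : ZMod 8) = c) :
      r.num = c * r.den := by
    obtain ⟨p, hpgt, hp, hmod⟩ := Nat.forall_exists_prime_gt_and_modEq
      (N + r.den + (r.num - c * r.den).natAbs + 2) (by norm_num) ha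
    have := Fact.mk hp
    have hleg : legendreSym p 2 = c := by
      rw [legendreSym.at_two (by lia), (ZMod.natCast_eq_natCast_iff p a 8).2 hmod, hc]
    have hr := h p hp (by lia)
    rw [hleg] at hr
    exact eq_mul_of_zmod_eq r.den_pos (by lia) (by lia) hr
  have h_one := key 1 (by decide) 1 (by decide)
  have h_three := key 3 (by decide) (-1) (by decide)
  have := r.den_pos
  lia
end

section
/- There is no rational number r such that for all sufficiently large primes p the image of r in ZMod p equals the image of s_p(1) = 1 + ∑_{k=1}^{p−1} (−1)^{k−1}·C_{k−1}/2^{2k−1} in ZMod p, where C_j is the j-th Catalan number. In other words, the element (s_p(1) mod p)_p of the poor man's adèle ring — a finite analogue of √2 — is irrational. -/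
/-- The `j`-th Catalan number `C_j = binom(2j, j) − binom(2j, j+1)`, as a rational number. -/
def catalanQ (j : ℕ) : ℚ := (Nat.choose (2 * j) j : ℚ) - (Nat.choose (2 * j) (j + 1) : ℚ)

/-- `s_p(1)`: the truncation at degree `p−1` of the binomial series for `√(1+x)`,
evaluated at `x = 1`. -/
def sTrunc (p : ℕ) : ℚ :=
  1 + ∑ k ∈ Finset.Icc 1 (p - 1), (-1 : ℚ) ^ (k - 1) * catalanQ (k - 1) / 2 ^ (2 * k - 1)

theorem Rat.cast_sum_of_ne_zero {ι α : Type*} [DivisionRing α] (s : Finset ι) (f : ι → ℚ)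
    (h : ∀ i ∈ s, ((f i).den : α) ≠ 0) :
    ((∑ i ∈ s, f i).den : α) ≠ 0 ∧ ((∑ i ∈ s, f i : ℚ) : α) = ∑ i ∈ s, (f i : α) := by
  classical
  induction s using Finset.induction_on with
  | empty => simp
  | insert i s hi ih =>
    obtain ⟨hden, hsum⟩ := ih fun j hj => h j (Finset.mem_insert_of_mem hj)
    have hi' := h i (Finset.mem_insert_self i s)
    rw [Finset.sum_insert hi, Finset.sum_insert hi, Rat.cast_add_of_ne_zero hi' hden, hsum]
    refine ⟨fun h0 => mul_ne_zero hi' hden ?_, rfl⟩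
    obtain ⟨c, hc⟩ := Rat.add_den_dvd (f i) (∑ j ∈ s, f j)
    rw [← Nat.cast_mul, hc, Nat.cast_mul, h0, zero_mul]

theorem catalanQ_eq_catalan (j : ℕ) : catalanQ j = (catalan j : ℚ) := by
  have h₁ : ((2 * j).choose (j + 1) : ℚ) * (j + 1) = (2 * j).choose j * j := by
    have h := Nat.choose_succ_right_eq (2 * j) j
    rw [two_mul, Nat.add_sub_cancel, ← two_mul] at h
    exact_mod_cast h
  have h₂ : ((j : ℚ) + 1) * catalan j = (2 * j).choose j := by
    exact_mod_cast succ_mul_catalan_eq_centralBinom j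
  have hj : (j : ℚ) + 1 ≠ 0 := by positivity
  apply mul_left_cancel₀ hj
  rw [h₂, catalanQ]
  linear_combination -h₁

theorem add_two_mul_catalan_succ (k : ℕ) :
    (k + 2) * catalan (k + 1) = 2 * (2 * k + 1) * catalan k := by
  apply Nat.eq_of_mul_eq_mul_left k.succ_pos
  have h₁ := succ_mul_catalan_eq_centralBinom (k + 1)
  have h₂ := succ_mul_catalan_eq_centralBinom k
  have h₃ := Nat.succ_mul_centralBinom_succ k
  rw [← h₁, ← h₂] at h₃
  rw [Nat.succ_eq_add_one]
  linear_combination h₃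

theorem cast_choose_mul_sub {R : Type*} [CommRing R] (n k : ℕ) :
    (n.choose (k + 1) : R) * (k + 1) = n.choose k * (n - k) := by
  rcases le_or_gt k n with h | h
  · rw [← Nat.cast_sub h]
    exact_mod_cast congrArg (Nat.cast (R := R)) (Nat.choose_succ_right_eq n k)
  · simp [Nat.choose_eq_zero_of_lt h, Nat.choose_eq_zero_of_lt (h.trans k.lt_succ_self)]

section

variable {p : ℕ} [Fact p.Prime]

theorem ZMod.two_ne_zero_of_ne_two (hp : p ≠ 2) : (2 : ZMod p) ≠ 0 := by
  have h := Fact.out (p := p.Prime)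
  rw [← Nat.cast_ofNat, Ne, ZMod.natCast_eq_zero_iff, Nat.prime_dvd_prime_iff_eq h Nat.prime_two]
  exact hp

/-- If `2 n = 1` in `ZMod p`, the coefficients of `(1 + x) ^ n` agree modulo `p` with those of
`√(1 + x)` up to degree `p - 1`. -/
theorem ZMod.choose_succ_eq_catalan {n : ℕ} (hp : p ≠ 2) (hn : (2 : ZMod p) * n = 1) {k : ℕ}
    (hk : k + 1 < p) :
    (n.choose (k + 1) : ZMod p) = (-1) ^ k * catalan k / 2 ^ (2 * k + 1) := by
  have h2 := ZMod.two_ne_zero_of_ne_two hp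
  induction k with
  | zero =>
    simp only [zero_add, Nat.choose_one_right, pow_zero, catalan_zero, Nat.cast_one, mul_zero,
      pow_one]
    field_simp
    linear_combination hn
  | succ k ih =>
    have hk2 : ((k : ZMod p) + 2) ≠ 0 := by
      have h : ((k + 2 : ℕ) : ZMod p) ≠ 0 := by
        rw [Ne, ZMod.natCast_eq_zero_iff]
        exact Nat.not_dvd_of_pos_of_lt (by omega) hk
      exact_mod_cast h
    have hc := cast_choose_mul_sub (R := ZMod p) n (k + 1)
    have hcat : ((k : ZMod p) + 2) * catalan (k + 1) = 2 * (2 * k + 1) * catalan k := by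
      exact_mod_cast congrArg (Nat.cast (R := ZMod p)) (add_two_mul_catalan_succ k)
    rw [ih (by omega)] at hc
    rw [eq_div_iff (pow_ne_zero _ h2)]
    apply mul_right_cancel₀ hk2
    field_simp at hc
    push_cast at hc
    linear_combination 4 * hc + (-1) ^ k * hcat + 2 * (-1) ^ k * catalan k * hn

/-- Reduction modulo `p` of the truncated binomial series is `(1 + 1) ^ n` when `2 n = 1`. -/
theorem cast_sTrunc {n : ℕ} (hp : p ≠ 2) (hn : (2 : ZMod p) * n = 1) (hnp : n < p) :
    (sTrunc p : ZMod p) = 2 ^ n := by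
  have h2 := ZMod.two_ne_zero_of_ne_two hp
  have hpow (m : ℕ) : ((2 ^ m : ℕ) : ZMod p) ≠ 0 := by
    push_cast
    exact pow_ne_zero _ h2
  have hterm (k : ℕ) : (-1 : ℚ) ^ k * catalanQ k / 2 ^ (2 * k + 1) =
      Rat.divInt ((-1) ^ k * catalan k) ((2 ^ (2 * k + 1) : ℕ) : ℤ) := by
    rw [catalanQ_eq_catalan, Rat.divInt_eq_div]
    push_cast
    rfl
  have hden (k : ℕ) :
      (((-1 : ℚ) ^ k * catalanQ k / 2 ^ (2 * k + 1)).den : ZMod p) ≠ 0 := by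
    rw [hterm]
    intro h
    rw [ZMod.natCast_eq_zero_iff] at h
    apply hpow (2 * k + 1)
    rw [ZMod.natCast_eq_zero_iff]
    exact h.trans (Int.natCast_dvd_natCast.mp (Rat.den_dvd _ _))
  obtain ⟨hsum_den, hsum⟩ := Rat.cast_sum_of_ne_zero (α := ZMod p) (Finset.range (p - 1)) _
    fun k _ => hden k
  have hs : sTrunc p =
      1 + ∑ k ∈ Finset.range (p - 1), (-1 : ℚ) ^ k * catalanQ k / 2 ^ (2 * k + 1) := by
    rw [sTrunc, ← Finset.Ico_add_one_right_eq_Icc, Finset.sum_Ico_eq_sum_range,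
      Nat.add_sub_cancel]
    congr 1
    refine Finset.sum_congr rfl fun k _ => ?_
    rw [Nat.add_sub_cancel_left, show 2 * (1 + k) - 1 = 2 * k + 1 by omega]
  rw [hs, Rat.cast_add_of_ne_zero (by simp) hsum_den, hsum, Rat.cast_one]
  have hchoose : (2 : ZMod p) ^ n = ∑ k ∈ Finset.range (n + 1), (n.choose k : ZMod p) := by
    exact_mod_cast congrArg (Nat.cast (R := ZMod p)) (Nat.sum_range_choose n).symm
  have hext : ∑ k ∈ Finset.range (n + 1), (n.choose k : ZMod p) =
      ∑ k ∈ Finset.range (p - 1 + 1), (n.choose k : ZMod p) := by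
    apply Finset.sum_subset
    · rw [Finset.range_subset_range]
      omega
    · intro k _ hk
      rw [Nat.choose_eq_zero_of_lt (by simpa using hk), Nat.cast_zero]
  rw [hchoose, hext, Finset.sum_range_succ', Nat.choose_zero_right, Nat.cast_one, add_comm]
  congr 1
  refine Finset.sum_congr rfl fun k hk => ?_
  rw [ZMod.choose_succ_eq_catalan hp hn (by rw [Finset.mem_range] at hk; omega), hterm,
    Rat.cast_divInt_of_ne_zero _ (by exact_mod_cast hpow _)]
  push_cast
  rfl

/-- Modulo an odd prime `p`, the truncated binomial series reduces to `2 * (2 / p)`. -/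
theorem cast_sTrunc_eq_legendreSym (hp : p ≠ 2) :
    (sTrunc p : ZMod p) = 2 * (legendreSym p 2 : ZMod p) := by
  have hodd := (Fact.out (p := p.Prime)).eq_two_or_odd.resolve_left hp
  have hle := (Fact.out (p := p.Prime)).two_le
  have hn : (2 : ZMod p) * (p / 2 + 1 : ℕ) = 1 := by
    have h : 2 * (p / 2 + 1) = p + 1 := by omega
    have h' := congrArg (Nat.cast (R := ZMod p)) h
    push_cast at h' ⊢
    simpa using h'
  rw [cast_sTrunc hp hn (by omega), legendreSym.eq_pow, pow_succ, mul_comm]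
  norm_num

end

/-- A rational number that reduces to the integer `a` modulo arbitrarily large primes is `a`. -/
theorem Rat.eq_intCast_of_frequently_zmod (r : ℚ) (a : ℤ)
    (h : ∀ N : ℕ, ∃ p > N, p.Prime ∧ (r.num : ZMod p) * (r.den : ZMod p)⁻¹ = a) : r = a := by
  obtain ⟨p, hlt, hp, hr⟩ := h (r.den + (r.num - a * r.den).natAbs)
  have : Fact p.Prime := ⟨hp⟩
  have hden : (r.den : ZMod p) ≠ 0 := by
    rw [Ne, ZMod.natCast_eq_zero_iff]
    exact Nat.not_dvd_of_pos_of_lt r.den_pos (by omega)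
  rw [← div_eq_mul_inv, div_eq_iff hden] at hr
  have hdvd : (p : ℤ) ∣ r.num - a * r.den := by
    rw [← ZMod.intCast_zmod_eq_zero_iff_dvd]
    push_cast
    rw [hr, sub_self]
  have hzero := Int.eq_zero_of_dvd_of_natAbs_lt_natAbs hdvd (by rw [Int.natAbs_natCast]; omega)
  have hq : (r.num : ℚ) = a * r.den := by exact_mod_cast sub_eq_zero.mp hzero
  exact mul_right_cancel₀ (Nat.cast_ne_zero.mpr r.den_ne_zero) ((Rat.mul_den_eq_num r).trans hq)

/-- There is no rational number `r` whose image in `ZMod p` equals that of `s_p(1)` for all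
sufficiently large primes `p`: the element `(s_p(1) mod p)_p` of the poor man's adèle ring,
a finite analogue of `√2`, is irrational. -/
theorem sqrt_two_analogue_irrational :
    ¬ ∃ (r : ℚ) (N : ℕ), ∀ p : ℕ, p.Prime → N ≤ p →
      (r.num : ZMod p) * (r.den : ZMod p)⁻¹ =
        ((sTrunc p).num : ZMod p) * ((sTrunc p).den : ZMod p)⁻¹ := by
  rintro ⟨r, N, h⟩
  have hcongr (b : ZMod 8) (hb : IsUnit b) : r = (2 * ZMod.χ₈ b : ℤ) := by
    apply Rat.eq_intCast_of_frequently_zmod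
    intro M
    obtain ⟨p, hlt, hp, hpb⟩ := Nat.forall_exists_prime_gt_and_eq_mod hb (M + N + 2)
    have : Fact p.Prime := ⟨hp⟩
    refine ⟨p, by omega, hp, ?_⟩
    have hp2 : p ≠ 2 := by omega
    rw [h p hp (by omega), ← div_eq_mul_inv, ← Rat.cast_def, cast_sTrunc_eq_legendreSym hp2,
      legendreSym.at_two hp2, hpb]
    push_cast
    rfl
  have h1 := hcongr 1 isUnit_one
  rw [hcongr 3 (by decide)] at h1
  exact absurd (Int.cast_injective h1) (by decide)
end

section
/- If s and t are rational numbers such that for all sufficiently large primes p the images of s and t in ZMod p coincide (in particular the denominators of s and t are coprime to such p), then s = t. Consequently, the field ℚ embeds injectively into the poor man's adèle ring via the diagonal embedding. -/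
/-- If two rationals have the same image in `ZMod p` for all sufficiently large primes `p`
(their denominators being coprime to such `p`), then they are equal. Consequently `ℚ` embeds
injectively into the poor man's adèle ring via the diagonal embedding. -/
theorem rat_eq_of_eventually_congr (s t : ℚ)
    (h : ∃ N : ℕ, ∀ p : ℕ, p.Prime → N ≤ p →
      Nat.Coprime s.den p ∧ Nat.Coprime t.den p ∧
      (s.num : ZMod p) * (s.den : ZMod p)⁻¹ = (t.num : ZMod p) * (t.den : ZMod p)⁻¹) :
    s = t := by
  obtain ⟨N, h⟩ := h
  obtain ⟨p, hp, hprime⟩ :=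
    Nat.exists_infinite_primes (max N ((s.num * t.den - t.num * s.den).natAbs + 1))
  obtain ⟨hs, ht, heq⟩ := h p hprime (le_trans (le_max_left _ _) hp)
  have hlt : (s.num * t.den - t.num * s.den).natAbs < p := le_trans (le_max_right _ _) hp
  have hs' := ZMod.coe_mul_inv_eq_one s.den hs
  have ht' := ZMod.coe_mul_inv_eq_one t.den ht
  have hcross : ((s.num * t.den - t.num * s.den : ℤ) : ZMod p) = 0 := by
    push_cast
    linear_combination (s.den : ZMod p) * t.den * heq - (s.num : ZMod p) * t.den * hs' +
      (t.num : ZMod p) * s.den * ht'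
  have hdvd := (ZMod.intCast_zmod_eq_zero_iff_dvd _ p).1 hcross
  have hzero := Int.eq_zero_of_dvd_of_natAbs_lt_natAbs hdvd (by simpa using hlt)
  exact Rat.eq_iff_mul_eq_mul.2 (sub_eq_zero.1 hzero)
end

section
/- Let q_0 ≥ 2 be an integer. There exists a constant C > 0 such that for all real X ≥ 3 the number of primes p with X ≤ p ≤ 2X for which there exists an integer n with 1 ≤ n ≤ √X/log X and p dividing q_0^n − 1 is at most C·X/(log X)³. -/
/-- If every prime factor in a finset `T` of prime factors of `m ≠ 0` is at least `X ≥ 0`, then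
`X ^ #T ≤ m`. -/
theorem pow_card_le_of_subset_primeFactors {m : ℕ} (hm : m ≠ 0) {T : Finset ℕ}
    (hT : T ⊆ m.primeFactors) {X : ℝ} (hX : 0 ≤ X) (hle : ∀ p ∈ T, X ≤ (p : ℝ)) :
    X ^ T.card ≤ (m : ℝ) := by
  have hdvd : ∏ p ∈ T, p ∣ m :=
    (Finset.prod_dvd_prod_of_subset _ _ _ hT).trans (Nat.prod_primeFactors_dvd m)
  calc X ^ T.card = ∏ _p ∈ T, X := by simp
    _ ≤ ∏ p ∈ T, (p : ℝ) := Finset.prod_le_prod (fun _ _ => hX) hle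
    _ = ((∏ p ∈ T, p : ℕ) : ℝ) := by push_cast; rfl
    _ ≤ m := by exact_mod_cast Nat.le_of_dvd (Nat.pos_of_ne_zero hm) hdvd

theorem prod_pow_sub_one_ne_zero {q : ℕ} (hq : 2 ≤ q) (N : ℕ) :
    ∏ n ∈ Finset.Icc 1 N, (q ^ n - 1) ≠ 0 := by
  refine Finset.prod_ne_zero_iff.mpr fun n hn => ?_
  have := Nat.one_lt_pow (n := n) (by have := (Finset.mem_Icc.mp hn).1; omega) (by omega : 1 < q)
  omega

theorem prod_pow_sub_one_le {q : ℕ} (hq : 2 ≤ q) (N : ℕ) :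
    ∏ n ∈ Finset.Icc 1 N, (q ^ n - 1) ≤ q ^ (N * N) := by
  have h := Finset.prod_le_pow_card (Finset.Icc 1 N) (fun n => q ^ n - 1) (q ^ N) fun n hn =>
    (Nat.sub_le _ _).trans (Nat.pow_le_pow_right (by omega) (Finset.mem_Icc.mp hn).2)
  simpa [← pow_mul] using h

/-- For an integer `q₀ ≥ 2`, the number of primes `p ∈ [X, 2X]` dividing `q₀^n − 1` for some
`1 ≤ n ≤ √X/log X` is `O(X/(log X)³)`. -/
theorem few_primes_dividing_small_power_minus_one (q₀ : ℕ) (hq₀ : 2 ≤ q₀) :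
    ∃ C : ℝ, 0 < C ∧ ∀ X : ℝ, 3 ≤ X →
      ({p : ℕ | p.Prime ∧ X ≤ (p : ℝ) ∧ (p : ℝ) ≤ 2 * X ∧
          ∃ n : ℕ, 1 ≤ n ∧ (n : ℝ) ≤ Real.sqrt X / Real.log X ∧
            (p : ℤ) ∣ (q₀ : ℤ) ^ n - 1}.ncard : ℝ) ≤
        C * X / (Real.log X) ^ 3 := by
  have hq : (1 : ℝ) < q₀ := by exact_mod_cast hq₀
  refine ⟨Real.log q₀, Real.log_pos hq, fun X hX => ?_⟩
  have hlog : 0 < Real.log X := Real.log_pos (by linarith)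
  set N : ℕ := ⌊Real.sqrt X / Real.log X⌋₊
  set m : ℕ := ∏ n ∈ Finset.Icc 1 N, (q₀ ^ n - 1)
  have hm : m ≠ 0 := prod_pow_sub_one_ne_zero hq₀ N
  set T : Finset ℕ := {p ∈ m.primeFactors | X ≤ (p : ℝ)}
  have hcard : ({p : ℕ | p.Prime ∧ X ≤ (p : ℝ) ∧ (p : ℝ) ≤ 2 * X ∧
      ∃ n : ℕ, 1 ≤ n ∧ (n : ℝ) ≤ Real.sqrt X / Real.log X ∧
        (p : ℤ) ∣ (q₀ : ℤ) ^ n - 1}.ncard) ≤ T.card := by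
    rw [← Set.ncard_coe_finset]
    refine Set.ncard_le_ncard ?_ T.finite_toSet
    rintro p ⟨hp, hXp, -, n, hn, hnX, hdvd⟩
    have hdvd' : p ∣ q₀ ^ n - 1 := by
      rw [← Int.natCast_dvd_natCast, Nat.cast_sub (Nat.one_le_pow _ _ (by omega))]
      exact_mod_cast hdvd
    exact Finset.mem_filter.mpr ⟨Nat.mem_primeFactors.mpr ⟨hp, hdvd'.trans
      (Finset.dvd_prod_of_mem _ (Finset.mem_Icc.mpr ⟨hn, Nat.le_floor hnX⟩)), hm⟩, hXp⟩
  have hpow : X ^ T.card ≤ (q₀ : ℝ) ^ (N * N) :=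
    (pow_card_le_of_subset_primeFactors hm (Finset.filter_subset _ _) (by linarith)
      fun p hp => (Finset.mem_filter.mp hp).2).trans
      (by exact_mod_cast prod_pow_sub_one_le hq₀ N)
  have hlogs : (T.card : ℝ) * Real.log X ≤ (N * N : ℝ) * Real.log q₀ := by
    have h := Real.log_le_log (by positivity) hpow
    rwa [Real.log_pow, Real.log_pow, Nat.cast_mul] at h
  have hN : (N * N : ℝ) ≤ X / Real.log X ^ 2 := by
    have h : (N : ℝ) ≤ Real.sqrt X / Real.log X := Nat.floor_le (by positivity)
    calc (N * N : ℝ) ≤ (Real.sqrt X / Real.log X) * (Real.sqrt X / Real.log X) := by gcongr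
      _ = X / Real.log X ^ 2 := by
        rw [div_mul_div_comm, Real.mul_self_sqrt (by linarith), sq]
  calc _ ≤ (T.card : ℝ) := by exact_mod_cast hcard
    _ ≤ (N * N : ℝ) * Real.log q₀ / Real.log X := (le_div_iff₀ hlog).mpr hlogs
    _ ≤ X / Real.log X ^ 2 * Real.log q₀ / Real.log X := by
      have := Real.log_pos hq
      gcongr
    _ = Real.log q₀ * X / Real.log X ^ 3 := by field_simp
end

section
/- Let δ = 1 − (1 + log log 2)/log 2 = 0.086071… be the Erdős–Ford–Tenenbaum constant. There exists a constant C > 0 such that for all sufficiently large real X, the number of primes p ≤ 2X for which p − 1 has a divisor d in the interval [√X/log X, 2·√X·log X] is at most C·X·(log log X)^C/(log X)^{1+δ}. -/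
open Real

open Finset in
lemma card_coprime_periodic {P Q : ℕ → Prop} [DecidablePred P] [DecidablePred Q] {m n : ℕ}
    (hm : 0 < m) (hn : 0 < n) (hmn : m.Coprime n)
    (hP : Function.Periodic P m) (hQ : Function.Periodic Q n) :
    Nat.count (fun b => P b ∧ Q b) (m * n) = Nat.count P m * Nat.count Q n := by
  simp only [Nat.count_eq_card_filter_range]
  rw [← card_product]
  refine card_nbij' (fun b => (b % m, b % n)) (fun c => (Nat.chineseRemainder hmn c.1 c.2 : ℕ))
    ?_ ?_ ?_ ?_
  · intro b hb
    simp only [coe_filter, mem_range, Set.mem_ofPred_eq, coe_product, Set.mem_prod] at hb ⊢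
    exact ⟨⟨Nat.mod_lt _ hm, by rw [hP.map_mod_nat]; exact hb.2.1⟩,
      ⟨Nat.mod_lt _ hn, by rw [hQ.map_mod_nat]; exact hb.2.2⟩⟩
  · rintro ⟨c, d⟩ hc
    simp only [coe_filter, mem_range, Set.mem_ofPred_eq, coe_product, Set.mem_prod] at hc ⊢
    have h := (Nat.chineseRemainder hmn c d).2
    refine ⟨Nat.chineseRemainder_lt_mul hmn c d hm.ne' hn.ne', ?_, ?_⟩
    · rw [← hP.map_mod_nat, h.1, hP.map_mod_nat]; exact hc.1.2
    · rw [← hQ.map_mod_nat, h.2, hQ.map_mod_nat]; exact hc.2.2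
  · intro b hb
    simp only [coe_filter, mem_range, Set.mem_ofPred_eq] at hb
    have h := (Nat.chineseRemainder hmn (b % m) (b % n)).2
    have h' := (Nat.modEq_and_modEq_iff_modEq_mul hmn).1
      ⟨h.1.trans (Nat.mod_modEq b m), h.2.trans (Nat.mod_modEq b n)⟩
    exact Nat.ModEq.eq_of_lt_of_lt h'
      (Nat.chineseRemainder_lt_mul hmn _ _ hm.ne' hn.ne') hb.1
  · rintro ⟨c, d⟩ hc
    simp only [coe_filter, mem_range, Set.mem_ofPred_eq, coe_product, Set.mem_prod] at hc
    have h := (Nat.chineseRemainder hmn c d).2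
    have h1 : _ % m = c % m := h.1
    have h2 : _ % n = d % n := h.2
    rw [Nat.mod_eq_of_lt hc.1.1] at h1
    rw [Nat.mod_eq_of_lt hc.2.1] at h2
    exact Prod.ext h1 h2

open Finset in
lemma periodic_forall_mem_prod {R : ℕ → ℕ → Prop} (hR : ∀ p, Function.Periodic (R p) p)
    (T : Finset ℕ) : Function.Periodic (fun b => ∀ p ∈ T, R p b) (∏ p ∈ T, p) := by
  intro b
  refine propext (forall₂_congr fun p hp => ?_)
  obtain ⟨c, hc⟩ := dvd_prod_of_mem (fun p : ℕ => p) hp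
  have := (hR p).nat_mul c b
  rw [hc, mul_comm]
  exact this ▸ Iff.rfl

open Finset in
lemma count_forall_mem_prod {R : ℕ → ℕ → Prop} [∀ p, DecidablePred (R p)]
    (hR : ∀ p, Function.Periodic (R p) p) (T : Finset ℕ) (hT : ∀ p ∈ T, p.Prime) :
    Nat.count (fun b => ∀ p ∈ T, R p b) (∏ p ∈ T, p) = ∏ p ∈ T, Nat.count (R p) p := by
  classical
  induction T using Finset.induction_on with
  | empty => simp
  | insert q T hq ih =>
    rw [prod_insert hq, prod_insert hq, ← ih fun p hp => hT p (mem_insert_of_mem hp)]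
    have hcop : q.Coprime (∏ p ∈ T, p) := Nat.Coprime.prod_right fun p hp =>
      (Nat.coprime_primes (hT q (mem_insert_self _ _)) (hT p (mem_insert_of_mem hp))).2
        (by rintro rfl; exact hq hp)
    rw [← card_coprime_periodic (hT q (mem_insert_self _ _)).pos
      (prod_pos fun p hp => (hT p (mem_insert_of_mem hp)).pos) hcop (hR q)
      (periodic_forall_mem_prod hR T)]
    congr 1
    ext b
    simp

lemma abs_count_sub_le_of_periodic {P : ℕ → Prop} [DecidablePred P] {D : ℕ} (hD : 0 < D)
    (hP : Function.Periodic P D) (N : ℕ) :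
    |(Nat.count P N : ℝ) - N * (Nat.count P D / D)| ≤ D := by
  have hblock : ∀ q r, Nat.count P (D * q + r) = q * Nat.count P D + Nat.count P r := by
    intro q r
    induction q with
    | zero => simp
    | succ q ih =>
      rw [show D * (q + 1) + r = D + (D * q + r) by ring, Nat.count_add]
      have : (fun k => P (D + k)) = P := by
        ext k; rw [add_comm, hP]
      simp only [this]
      rw [ih]; ring
  have hc : (Nat.count P D : ℝ) ≤ D := by exact_mod_cast Nat.count_le _
  have hr : Nat.count P (N % D) ≤ Nat.count P D := Nat.count_monotone P (Nat.mod_lt N hD).le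
  have hr' : (Nat.count P (N % D) : ℝ) ≤ Nat.count P D := by exact_mod_cast hr
  have hN := Nat.div_add_mod N D
  have h1 : (Nat.count P N : ℝ) = (N / D : ℕ) * Nat.count P D + Nat.count P (N % D) := by
    rw [← hN, hblock]; push_cast; rw [hN]
  have h2 : (N : ℝ) = D * (N / D : ℕ) + (N % D : ℕ) := by exact_mod_cast hN.symm
  have hD' : (0 : ℝ) < D := by exact_mod_cast hD
  have h3 : (N : ℝ) * (Nat.count P D / D) =
      (N / D : ℕ) * Nat.count P D + (N % D : ℕ) / D * Nat.count P D := by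
    rw [h2]; field_simp
  have h4 : ((N % D : ℕ) : ℝ) / D ≤ 1 := by
    rw [div_le_one hD']; exact_mod_cast (Nat.mod_lt N hD).le
  have h5 : (0 : ℝ) ≤ ((N % D : ℕ) : ℝ) / D := by positivity
  have h6 : (0 : ℝ) ≤ Nat.count P D := by positivity
  have h7 : (0 : ℝ) ≤ Nat.count P (N % D) := by positivity
  rw [h1, h3, abs_le]
  constructor <;> nlinarith [mul_le_mul_of_nonneg_right h4 h6, mul_nonneg h5 h6]

open Finset in
lemma bonferroni_upper {ι : Type*} [DecidableEq ι] (B : Finset ι) {k : ℕ} (hk : Even k) :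
    (if B = ∅ then 1 else 0 : ℝ) ≤ ∑ T ∈ B.powerset with T.card ≤ k, (-1) ^ T.card := by
  have h := sum_powerset_apply_card (fun j => if j ≤ k then (-1 : ℝ) ^ j else 0) (x := B)
  rw [sum_filter, h]
  split_ifs with hB
  · simp [hB]
  · obtain ⟨n, hn⟩ : ∃ n, B.card = n + 1 := Nat.exists_eq_succ_of_ne_zero (by simpa using hB)
    have h1 := Int.alternating_sum_range_choose_eq_choose (n := n) (m := k)
    rw [hk.neg_one_pow, one_mul] at h1
    have h2 : ∑ j ∈ range (B.card + 1), B.card.choose j • (if j ≤ k then (-1 : ℝ) ^ j else 0)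
        = ((∑ j ∈ range (k + 1), (-1) ^ j * ((n + 1).choose j : ℤ) : ℤ) : ℝ) := by
      push_cast
      simp only [nsmul_eq_mul, mul_ite, mul_zero]
      rw [← sum_filter]
      have h3 : ∀ j ∈ range (k + 1), j ∉ (range (B.card + 1)).filter (· ≤ k) →
          (-1 : ℝ) ^ j * ((n + 1).choose j : ℝ) = 0 := by
        intro j hj hj'
        simp only [mem_filter, mem_range, not_and] at hj hj'
        rw [Nat.choose_eq_zero_of_lt (by by_contra hc; exact hj' (by omega) (by omega))]
        simp
      rw [← sum_subset _ h3]
      · exact sum_congr rfl fun j _ => by rw [hn]; ring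
      · intro j hj
        simp only [mem_filter, mem_range] at hj ⊢
        omega
    rw [h2, h1]
    positivity

open Finset in
lemma brun_sieve {R : ℕ → ℕ → Prop} [∀ p, DecidablePred (R p)]
    (hR : ∀ p, Function.Periodic (R p) p) (S : Finset ℕ) (hS : ∀ p ∈ S, p.Prime)
    {w : ℕ} (hw : 0 < w) (hSw : ∀ p ∈ S, p ≤ w) (hcard : S.card ≤ w)
    {k : ℕ} (hk : Even k) (N : ℕ) :
    (Nat.count (fun b => ∀ p ∈ S, ¬ R p b) N : ℝ) ≤
      N * (Real.exp (-∑ p ∈ S, (Nat.count (R p) p / p : ℝ)) +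
        Real.exp (-k + Real.exp 1 * ∑ p ∈ S, (Nat.count (R p) p / p : ℝ))) +
      3 * (w : ℝ) ^ (2 * k) := by
  classical
  set x : ℕ → ℝ := fun p => (Nat.count (R p) p / p : ℝ) with hx
  have hx0 : ∀ p, 0 ≤ x p := fun p => by positivity
  have hx1 : ∀ p ∈ S, x p ≤ 1 := fun p hp => by
    have : (0 : ℝ) < p := by exact_mod_cast (hS p hp).pos
    rw [hx, div_le_one this]
    exact_mod_cast Nat.count_le _
  have hsub : ∀ T ∈ S.powerset, ∀ p ∈ T, p.Prime := fun T hT p hp => hS p (mem_powerset.1 hT hp)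
  -- the truncated inclusion-exclusion inequality
  have h1 : (Nat.count (fun b => ∀ p ∈ S, ¬ R p b) N : ℝ) ≤
      ∑ T ∈ S.powerset with T.card ≤ k, (-1) ^ T.card *
        (Nat.count (fun b => ∀ p ∈ T, R p b) N : ℝ) := by
    have e1 : (Nat.count (fun b => ∀ p ∈ S, ¬ R p b) N : ℝ) =
        ∑ b ∈ range N, (if S.filter (fun p => R p b) = ∅ then 1 else 0 : ℝ) := by
      rw [Nat.count_eq_card_filter_range, card_filter]
      push_cast
      refine sum_congr rfl fun b _ => ?_
      simp only [filter_eq_empty_iff]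
    have e2 : ∀ T : Finset ℕ, (Nat.count (fun b => ∀ p ∈ T, R p b) N : ℝ) =
        ∑ b ∈ range N, (if ∀ p ∈ T, R p b then 1 else 0 : ℝ) := by
      intro T
      rw [Nat.count_eq_card_filter_range, card_filter]
      push_cast
      rfl
    simp only [e1, e2, mul_sum]
    rw [sum_comm]
    refine sum_le_sum fun b _ => (bonferroni_upper _ hk).trans (le_of_eq ?_)
    simp only [mul_ite, mul_one, mul_zero]
    rw [← sum_filter]
    refine sum_congr ?_ fun _ _ => rfl
    ext T
    simp only [mem_filter, mem_powerset, subset_iff]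
    constructor
    · rintro ⟨h, h'⟩
      exact ⟨⟨fun p hp => (h hp).1, h'⟩, fun p hp => (h hp).2⟩
    · rintro ⟨⟨h, h'⟩, h''⟩
      exact ⟨fun p hp => ⟨h hp, h'' p hp⟩, h'⟩
  have h2 : ∀ T ∈ S.powerset, |(Nat.count (fun b => ∀ p ∈ T, R p b) N : ℝ) - N * ∏ p ∈ T, x p| ≤
      (w : ℝ) ^ T.card := by
    intro T hT
    have := abs_count_sub_le_of_periodic (prod_pos fun p hp => (hsub T hT p hp).pos)
      (periodic_forall_mem_prod hR T) N
    rw [count_forall_mem_prod hR T (hsub T hT)] at this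
    push_cast at this
    rw [← prod_div_distrib] at this
    refine this.trans ((prod_le_prod (fun _ _ => by positivity) fun p hp =>
      (Nat.cast_le.2 (hSw p (mem_powerset.1 hT hp)))).trans (by simp))
  have h3 : ∑ T ∈ S.powerset with T.card ≤ k, (-1) ^ T.card *
        (Nat.count (fun b => ∀ p ∈ T, R p b) N : ℝ) ≤
      N * ∑ T ∈ S.powerset with T.card ≤ k, (-1) ^ T.card * ∏ p ∈ T, x p +
        ∑ T ∈ S.powerset with T.card ≤ k, (w : ℝ) ^ T.card := by
    rw [mul_sum, ← sum_add_distrib]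
    refine sum_le_sum fun T hT => ?_
    have := abs_le.1 (h2 T (mem_filter.1 hT).1)
    rcases neg_one_pow_eq_or ℝ T.card with h | h <;> rw [h] <;> linarith
  have hw' : (1 : ℝ) ≤ w := by exact_mod_cast hw
  -- the error term
  have h4 : ∑ T ∈ S.powerset with T.card ≤ k, (w : ℝ) ^ T.card ≤ 3 * (w : ℝ) ^ (2 * k) := by
    calc ∑ T ∈ S.powerset with T.card ≤ k, (w : ℝ) ^ T.card
        ≤ ∑ T ∈ S.powerset with T.card ≤ k, (w : ℝ) ^ (2 * k) * (w⁻¹ : ℝ) ^ T.card := by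
          refine sum_le_sum fun T hT => ?_
          have := (mem_filter.1 hT).2
          rw [inv_pow, ← div_eq_mul_inv, le_div_iff₀ (by positivity), ← pow_add]
          exact pow_le_pow_right₀ hw' (by omega)
      _ ≤ ∑ T ∈ S.powerset, (w : ℝ) ^ (2 * k) * (w⁻¹ : ℝ) ^ T.card :=
          sum_le_sum_of_subset_of_nonneg (filter_subset _ _) fun _ _ _ => by positivity
      _ = (w : ℝ) ^ (2 * k) * (1 + (w : ℝ)⁻¹) ^ S.card := by
          rw [← mul_sum, ← prod_const, prod_one_add]
          simp
      _ ≤ (w : ℝ) ^ (2 * k) * 3 := by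
          gcongr
          calc (1 + (w : ℝ)⁻¹) ^ S.card ≤ (1 + (w : ℝ)⁻¹) ^ w :=
                pow_le_pow_right₀ (by simp) hcard
            _ ≤ (Real.exp (w : ℝ)⁻¹) ^ w := by
                gcongr
                rw [add_comm]
                exact Real.add_one_le_exp _
            _ = Real.exp 1 := by
                rw [← Real.exp_nat_mul, mul_inv_cancel₀ (by positivity)]
            _ ≤ 3 := Real.exp_one_lt_three.le
      _ = _ := mul_comm _ _
  -- the main term
  have h5 : ∑ T ∈ S.powerset with T.card ≤ k, (-1) ^ T.card * ∏ p ∈ T, x p ≤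
      Real.exp (-∑ p ∈ S, x p) + Real.exp (-k + Real.exp 1 * ∑ p ∈ S, x p) := by
    have a1 : ∑ T ∈ S.powerset, (-1) ^ T.card * ∏ p ∈ T, x p = ∏ p ∈ S, (1 - x p) := by
      simp only [sub_eq_add_neg, prod_one_add, prod_neg]
    have a2 : ∏ p ∈ S, (1 - x p) ≤ Real.exp (-∑ p ∈ S, x p) := by
      rw [← sum_neg_distrib, Real.exp_sum]
      exact prod_le_prod (fun p hp => sub_nonneg.2 (hx1 p hp)) fun p _ => by
        have := Real.add_one_le_exp (-x p)
        linarith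
    have a3 := sum_filter_add_sum_filter_not S.powerset (fun T => T.card ≤ k)
      (fun T => (-1) ^ T.card * ∏ p ∈ T, x p)
    have a4 : -∑ T ∈ S.powerset with ¬ T.card ≤ k, (-1) ^ T.card * ∏ p ∈ T, x p ≤
        Real.exp (-k + Real.exp 1 * ∑ p ∈ S, x p) := by
      calc -∑ T ∈ S.powerset with ¬ T.card ≤ k, (-1) ^ T.card * ∏ p ∈ T, x p
          ≤ ∑ T ∈ S.powerset with ¬ T.card ≤ k,
              Real.exp (-k) * ∏ p ∈ T, (Real.exp 1 * x p) := by
            rw [← sum_neg_distrib]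
            refine sum_le_sum fun T hT => ?_
            have hT' := (mem_filter.1 hT).2
            have b1 : (0 : ℝ) ≤ ∏ p ∈ T, x p := prod_nonneg fun p _ => hx0 p
            have b2 : 1 ≤ Real.exp (-k) * Real.exp 1 ^ T.card := by
              rw [← Real.exp_nat_mul, ← Real.exp_add, Real.one_le_exp_iff]
              have : (k : ℝ) ≤ T.card := by exact_mod_cast (not_le.1 hT').le
              linarith
            rw [prod_mul_distrib, prod_const, ← mul_assoc]
            refine le_trans ?_ (le_mul_of_one_le_left b1 b2)
            rcases neg_one_pow_eq_or ℝ T.card with h | h <;> rw [h] <;> linarith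
        _ ≤ ∑ T ∈ S.powerset, Real.exp (-k) * ∏ p ∈ T, (Real.exp 1 * x p) :=
            sum_le_sum_of_subset_of_nonneg (filter_subset _ _) fun T _ _ =>
              mul_nonneg (Real.exp_pos _).le
                (prod_nonneg fun p _ => mul_nonneg (Real.exp_pos _).le (hx0 p))
        _ = Real.exp (-k) * ∏ p ∈ S, (1 + Real.exp 1 * x p) := by
            rw [← mul_sum, prod_one_add]
        _ ≤ Real.exp (-k) * ∏ p ∈ S, Real.exp (Real.exp 1 * x p) := by
            gcongr with p hp
            rw [add_comm]; exact Real.add_one_le_exp _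
        _ = _ := by rw [← Real.exp_sum, ← mul_sum, ← Real.exp_add]
    linarith
  calc _ ≤ _ := h1.trans h3
    _ ≤ _ := by gcongr

open Finset in
lemma count_dvd_self_prime {p : ℕ} (hp : p.Prime) : Nat.count (fun b => p ∣ b) p = 1 := by
  rw [Nat.count_eq_card_filter_range, card_eq_one]
  refine ⟨0, ?_⟩
  ext b
  simp only [mem_filter, mem_range, mem_singleton]
  constructor
  · rintro ⟨h, h'⟩
    exact Nat.eq_zero_of_dvd_of_lt h' h
  · rintro rfl
    exact ⟨hp.pos, dvd_zero _⟩

open Finset in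
lemma count_dvd_or_dvd_mul_add_one {p : ℕ} (hp : p.Prime) (q : ℕ) :
    Nat.count (fun b => p ∣ b ∨ p ∣ q * b + 1) p = if p ∣ q then 1 else 2 := by
  have : Fact p.Prime := ⟨hp⟩
  split_ifs with h
  · refine Eq.trans ?_ (count_dvd_self_prime hp)
    congr 1
    ext b
    refine or_iff_left fun h' => hp.one_lt.ne' (Nat.dvd_one.1 ?_)
    exact (Nat.dvd_add_right (h.mul_right b)).1 h'
  · have hq : (q : ZMod p) ≠ 0 := fun h' => h ((ZMod.natCast_eq_zero_iff q p).1 h')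
    rw [Nat.count_eq_card_filter_range, card_eq_two]
    have key : ∀ b : ℕ, p ∣ q * b + 1 ↔ (b : ZMod p) = -(q : ZMod p)⁻¹ := by
      intro b
      rw [← ZMod.natCast_eq_zero_iff]
      push_cast
      constructor
      · intro h'
        field_simp
        linear_combination h'
      · intro h'
        rw [h']
        field_simp
        ring
    refine ⟨0, (-(q : ZMod p)⁻¹).val, ?_, ?_⟩
    · intro h'
      have := (ZMod.val_eq_zero _).1 h'.symm
      simp [hq] at this
    · ext b
      simp only [mem_filter, mem_range, mem_insert, mem_singleton, key]
      constructor
      · rintro ⟨hb, h' | h'⟩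
        · exact Or.inl (Nat.eq_zero_of_dvd_of_lt h' hb)
        · right
          rw [← h', ZMod.val_natCast, Nat.mod_eq_of_lt hb]
      · rintro (rfl | rfl)
        · exact ⟨hp.pos, Or.inl (dvd_zero _)⟩
        · exact ⟨ZMod.val_lt _, Or.inr (by simp)⟩

lemma periodic_dvd (p : ℕ) : Function.Periodic (fun b => p ∣ b) p := fun b => by simp

lemma periodic_dvd_mul_add_one (p q : ℕ) : Function.Periodic (fun b => p ∣ q * b + 1) p := by
  intro b
  have : q * (b + p) + 1 = q * b + 1 + p * q := by ring
  beta_reduce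
  rw [this]
  exact propext (Nat.dvd_add_left (Nat.dvd_mul_right p q))

/-- `recipSum w` is the sum of the reciprocals of the primes below `w`. -/
noncomputable def recipSum (w : ℕ) : ℝ := ∑ p ∈ w.primesBelow, (p : ℝ)⁻¹

lemma recipSum_nonneg (w : ℕ) : 0 ≤ recipSum w := Finset.sum_nonneg fun _ _ => by positivity

lemma card_primesBelow_le (w : ℕ) : w.primesBelow.card ≤ w :=
  (Finset.card_filter_le _ _).trans (by simp)

lemma count_rough_le {w : ℕ} (hw : 0 < w) {k : ℕ} (hk : Even k) (N : ℕ) :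
    (Nat.count (fun b => ∀ p ∈ w.primesBelow, ¬ p ∣ b) N : ℝ) ≤
      N * (Real.exp (-recipSum w) + Real.exp (-k + 6 * recipSum w)) + 3 * (w : ℝ) ^ (2 * k) := by
  have h := brun_sieve (R := fun p b => p ∣ b) periodic_dvd w.primesBelow
    (fun p hp => Nat.prime_of_mem_primesBelow hp) hw
    (fun p hp => (Nat.lt_of_mem_primesBelow hp).le) (card_primesBelow_le w) hk N
  have e : ∑ p ∈ w.primesBelow, (Nat.count (fun b => p ∣ b) p / p : ℝ) = recipSum w :=
    Finset.sum_congr rfl fun p hp => by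
      rw [count_dvd_self_prime (Nat.prime_of_mem_primesBelow hp)]; simp
  rw [e] at h
  refine h.trans ?_
  have := recipSum_nonneg w
  have := Real.exp_one_lt_three
  gcongr
  linarith

lemma count_rough_and_shift_rough_le {w : ℕ} (hw : 0 < w) {k : ℕ} (hk : Even k) (q N : ℕ) :
    (Nat.count (fun b => ∀ p ∈ w.primesBelow, ¬ (p ∣ b ∨ p ∣ q * b + 1)) N : ℝ) ≤
      N * (Real.exp (-2 * recipSum w + ∑ p ∈ w.primesBelow with p ∣ q, (p : ℝ)⁻¹) +
        Real.exp (-k + 6 * recipSum w)) + 3 * (w : ℝ) ^ (2 * k) := by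
  have h := brun_sieve (R := fun p b => p ∣ b ∨ p ∣ q * b + 1)
    (fun p b => by
      beta_reduce
      rw [show (p ∣ b + p) = (p ∣ b) from periodic_dvd p b,
        show (p ∣ q * (b + p) + 1) = (p ∣ q * b + 1) from periodic_dvd_mul_add_one p q b])
    w.primesBelow
    (fun p hp => Nat.prime_of_mem_primesBelow hp) hw
    (fun p hp => (Nat.lt_of_mem_primesBelow hp).le) (card_primesBelow_le w) hk N
  have e : ∑ p ∈ w.primesBelow, (Nat.count (fun b => p ∣ b ∨ p ∣ q * b + 1) p / p : ℝ) =
      2 * recipSum w - ∑ p ∈ w.primesBelow with p ∣ q, (p : ℝ)⁻¹ := by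
    rw [recipSum, Finset.mul_sum, Finset.sum_filter, ← Finset.sum_sub_distrib]
    refine Finset.sum_congr rfl fun p hp => ?_
    rw [count_dvd_or_dvd_mul_add_one (Nat.prime_of_mem_primesBelow hp)]
    split_ifs
    · simp [div_eq_mul_inv]; ring
    · simp [div_eq_mul_inv]
  rw [e] at h
  refine h.trans ?_
  have := recipSum_nonneg w
  have h0 : 0 ≤ ∑ p ∈ w.primesBelow with p ∣ q, (p : ℝ)⁻¹ :=
    Finset.sum_nonneg fun _ _ => by positivity
  have := Real.exp_one_lt_three
  have := Real.exp_pos 1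
  have h1 : -(2 * recipSum w - ∑ p ∈ w.primesBelow with p ∣ q, (p : ℝ)⁻¹) =
      -2 * recipSum w + ∑ p ∈ w.primesBelow with p ∣ q, (p : ℝ)⁻¹ := by ring
  have h2 : Real.exp 1 * (2 * recipSum w - ∑ p ∈ w.primesBelow with p ∣ q, (p : ℝ)⁻¹) ≤
      6 * recipSum w := by nlinarith
  rw [h1]
  gcongr

lemma inv_one_sub_le_exp {x : ℝ} (h0 : 0 ≤ x) (h1 : x ≤ 3 / 4) :
    (1 - x)⁻¹ ≤ Real.exp (x + 4 * x ^ 2) := by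
  rw [inv_le_iff_one_le_mul₀ (by linarith)]
  have h2 := Real.add_one_le_exp (x + 4 * x ^ 2)
  nlinarith [mul_le_mul_of_nonneg_right h2 (by linarith : 0 ≤ 1 - x), mul_nonneg h0 h0,
    mul_nonneg (mul_nonneg h0 h0) (by linarith : 0 ≤ 3 - 4 * x)]

lemma inv_one_sub_le_exp_four_mul {x : ℝ} (h0 : 0 ≤ x) (h1 : x ≤ 3 / 4) :
    (1 - x)⁻¹ ≤ Real.exp (4 * x) := by
  rw [inv_le_iff_one_le_mul₀ (by linarith)]
  have h2 := Real.add_one_le_exp (4 * x)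
  nlinarith [mul_le_mul_of_nonneg_right h2 (by linarith : 0 ≤ 1 - x)]

/-- The sum of the inverse squares. -/
noncomputable def invSqSum : ℝ := ∑' n : ℕ, ((n : ℝ) ^ 2)⁻¹

lemma sum_inv_sq_le (s : Finset ℕ) : ∑ n ∈ s, ((n : ℝ) ^ 2)⁻¹ ≤ invSqSum :=
  (Real.summable_nat_pow_inv.2 one_lt_two).sum_le_tsum s fun _ _ => by positivity

lemma prod_inv_one_sub_le {z : ℝ} (h0 : 0 ≤ z) (h1 : z ≤ 3 / 2) (w : ℕ) :
    ∏ p ∈ w.primesBelow, (1 - z / p)⁻¹ ≤ Real.exp (z * recipSum w + 9 * invSqSum) := by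
  have hp2 : ∀ p ∈ w.primesBelow, (2 : ℝ) ≤ p := fun p hp => by
    exact_mod_cast (Nat.prime_of_mem_primesBelow hp).two_le
  have hle : ∀ p ∈ w.primesBelow, z / p ≤ 3 / 4 := fun p hp => by
    have := hp2 p hp
    rw [div_le_iff₀ (by linarith)]
    linarith
  calc ∏ p ∈ w.primesBelow, (1 - z / p)⁻¹
      ≤ ∏ p ∈ w.primesBelow, Real.exp (z / p + 4 * (z / p) ^ 2) := by
        refine Finset.prod_le_prod (fun p hp => ?_) fun p hp =>
          inv_one_sub_le_exp (by positivity) (hle p hp)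
        have := hle p hp
        exact inv_nonneg.2 (by linarith)
    _ = Real.exp (∑ p ∈ w.primesBelow, (z / p + 4 * (z / p) ^ 2)) := (Real.exp_sum _ _).symm
    _ ≤ _ := by
        rw [Real.exp_le_exp, Finset.sum_add_distrib, recipSum, Finset.mul_sum]
        refine add_le_add (le_of_eq (Finset.sum_congr rfl fun _ _ => div_eq_mul_inv _ _)) ?_
        refine le_trans ?_ (mul_le_mul_of_nonneg_left (sum_inv_sq_le w.primesBelow) (by norm_num))
        rw [Finset.mul_sum]
        refine Finset.sum_le_sum fun p _ => ?_
        rw [div_pow, div_eq_mul_inv, ← mul_assoc]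
        gcongr
        nlinarith

lemma sum_smoothNumbers_le {f : ℕ →* ℝ} (h0 : ∀ n, 0 ≤ f n)
    (h1 : ∀ {p : ℕ}, p.Prime → f p < 1) {w : ℕ} {F : Finset ℕ}
    (hF : ∀ a ∈ F, a ∈ w.smoothNumbers) :
    ∑ a ∈ F, f a ≤ ∏ p ∈ w.primesBelow, (1 - f p)⁻¹ := by
  have h := (EulerProduct.summable_and_hasSum_smoothNumbers_prod_primesBelow_geometric
    (f := f) (fun hp => by rw [Real.norm_of_nonneg (h0 _)]; exact h1 hp) w).2
  have h2 := sum_le_hasSum (F.subtype (· ∈ w.smoothNumbers)) (fun _ _ => h0 _) h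
  rwa [Finset.sum_subtype_of_mem (fun a => f a) hF] at h2

/-- The completely multiplicative function `a ↦ z ^ Ω(a) / a`. -/
noncomputable def powCardFactorsDiv (z : ℝ) : ℕ →* ℝ where
  toFun a := z ^ ArithmeticFunction.cardFactors a / a
  map_one' := by simp
  map_mul' a b := by
    rcases eq_or_ne a 0 with rfl | ha
    · simp
    rcases eq_or_ne b 0 with rfl | hb
    · simp
    rw [ArithmeticFunction.cardFactors_mul ha hb, pow_add]
    push_cast
    exact mul_div_mul_comm _ _ _ _

lemma sum_pow_cardFactors_div_le {z : ℝ} (h0 : 0 ≤ z) (h1 : z ≤ 3 / 2) {w : ℕ} {F : Finset ℕ}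
    (hF : ∀ a ∈ F, a ∈ w.smoothNumbers) :
    ∑ a ∈ F, z ^ ArithmeticFunction.cardFactors a / a ≤
      Real.exp (z * recipSum w + 9 * invSqSum) := by
  refine (sum_smoothNumbers_le (f := powCardFactorsDiv z) (fun n => ?_) (fun {p} hp => ?_)
    hF).trans (le_trans (le_of_eq ?_) (prod_inv_one_sub_le h0 h1 w))
  · exact div_nonneg (pow_nonneg h0 _) (Nat.cast_nonneg n)
  · have : (2 : ℝ) ≤ p := by exact_mod_cast hp.two_le
    simp only [powCardFactorsDiv, MonoidHom.coe_mk, OneHom.coe_mk,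
      ArithmeticFunction.cardFactors_apply_prime hp, pow_one]
    rw [div_lt_one (by linarith)]
    linarith
  · refine Finset.prod_congr rfl fun p hp => ?_
    simp [powCardFactorsDiv,
      ArithmeticFunction.cardFactors_apply_prime (Nat.prime_of_mem_primesBelow hp)]

lemma log_le_exp_recipSum {w : ℕ} (hw : 0 < w) :
    Real.log w ≤ Real.exp (recipSum w + 9 * invSqSum) := by
  have h := sum_pow_cardFactors_div_le zero_le_one (by norm_num : (1 : ℝ) ≤ 3 / 2) (w := w)
    (F := Finset.Ico 1 w) fun a ha =>
      Nat.mem_smoothNumbers_of_lt (Finset.mem_Ico.1 ha).1 (Finset.mem_Ico.1 ha).2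
  rw [one_mul] at h
  refine le_trans ?_ h
  obtain ⟨n, rfl⟩ : ∃ n, w = n + 1 := ⟨w - 1, by omega⟩
  have h2 := log_add_one_le_harmonic n
  rw [harmonic_eq_sum_Icc] at h2
  push_cast at h2 ⊢
  refine h2.trans (le_of_eq ?_)
  simp only [one_pow, one_div]
  rfl

lemma sum_log_div_le {w : ℕ} (hw : 0 < w) :
    ∑ p ∈ w.primesBelow, Real.log p / p ≤ 2 * Real.log w := by
  have hdvd : ∏ p ∈ w.primesBelow, p ^ (w / p) ∣ w.factorial := by
    refine Finset.prod_dvd_of_isRelPrime (fun p hp q hq hpq => ?_) fun p hp => ?_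
    · exact Nat.coprime_iff_isRelPrime.1 (Nat.coprime_pow_primes _ _
        (Nat.prime_of_mem_primesBelow hp) (Nat.prime_of_mem_primesBelow hq) hpq)
    · rw [(Nat.prime_of_mem_primesBelow hp).pow_dvd_factorial_iff (Nat.lt_succ_self _)]
      refine le_trans (by simp) (Finset.single_le_sum (f := fun i => w / p ^ i)
        (fun _ _ => Nat.zero_le _) (Finset.mem_Ico.2 ⟨le_refl 1, Nat.succ_lt_succ ?_⟩))
      exact Nat.log_pos (Nat.prime_of_mem_primesBelow hp).one_lt (Nat.lt_of_mem_primesBelow hp).le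
  have hle := (Nat.le_of_dvd w.factorial_pos hdvd).trans w.factorial_le_pow
  have hw' : (0 : ℝ) < w := by exact_mod_cast hw
  have h1 : ∑ p ∈ w.primesBelow, (w / p : ℕ) * Real.log p ≤ w * Real.log w := by
    have h2 : ((∏ p ∈ w.primesBelow, p ^ (w / p) : ℕ) : ℝ) ≤ ((w ^ w : ℕ) : ℝ) := by
      exact_mod_cast hle
    push_cast at h2
    have h3 := Real.log_le_log (Finset.prod_pos fun p hp => by
      have := (Nat.prime_of_mem_primesBelow hp).pos
      positivity) h2
    rw [Real.log_prod fun p hp => by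
      have := (Nat.prime_of_mem_primesBelow hp).pos
      positivity] at h3
    simpa using h3
  have h4 : ∑ p ∈ w.primesBelow, w * (Real.log p / p) ≤
      ∑ p ∈ w.primesBelow, 2 * ((w / p : ℕ) * Real.log p) := by
    refine Finset.sum_le_sum fun p hp => ?_
    have hp0 := (Nat.prime_of_mem_primesBelow hp).pos
    have hpw := Nat.lt_of_mem_primesBelow hp
    have hlog : 0 ≤ Real.log p := Real.log_natCast_nonneg p
    have h5 : w < p * (w / p + 1) := by
      have := Nat.lt_mul_div_succ w hp0
      exact this
    have h6 : 1 ≤ w / p := (Nat.one_le_div_iff hp0).2 hpw.le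
    have h7 : (w : ℝ) ≤ p * (2 * (w / p : ℕ)) := by
      have : w ≤ p * (2 * (w / p)) := by nlinarith
      exact_mod_cast this
    have hp0' : (0 : ℝ) < p := by exact_mod_cast hp0
    rw [← mul_div_assoc, div_le_iff₀ hp0']
    nlinarith
  rw [← Finset.mul_sum, ← Finset.mul_sum] at h4
  have h8 : w * ∑ p ∈ w.primesBelow, Real.log p / p ≤ w * (2 * Real.log w) := by linarith
  exact le_of_mul_le_mul_left h8 hw'

/-- The completely multiplicative function `a ↦ a ^ (-s)`. -/
noncomputable def rpowNegHom (s : ℝ) : ℕ →* ℝ where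
  toFun a := (a : ℝ) ^ (-s)
  map_one' := by simp
  map_mul' a b := by
    push_cast
    exact Real.mul_rpow (Nat.cast_nonneg a) (Nat.cast_nonneg b)

lemma exp_recipSum_le_mul_log : ∃ C : ℝ, 0 < C ∧ ∃ w₀ : ℕ, ∀ w : ℕ, w₀ ≤ w →
    Real.exp (recipSum w) ≤ C * Real.log w := by
  have hlim := tendsto_sub_mul_tsum_nat_rpow
  have hev : ∀ᶠ s in nhdsWithin (1 : ℝ) (Set.Ioi 1),
      (s - 1) * ∑' n : ℕ, 1 / (n : ℝ) ^ s ≤ 2 :=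
    hlim.eventually (Iic_mem_nhds one_lt_two)
  have hs : Filter.Tendsto (fun w : ℕ => 1 + (Real.log w)⁻¹) Filter.atTop
      (nhdsWithin (1 : ℝ) (Set.Ioi 1)) := by
    have hl : Filter.Tendsto (fun w : ℕ => Real.log w) Filter.atTop Filter.atTop :=
      Real.tendsto_log_atTop.comp tendsto_natCast_atTop_atTop
    refine tendsto_nhdsWithin_iff.2 ⟨?_, ?_⟩
    · simpa using (tendsto_inv_atTop_zero.comp hl).const_add 1
    · filter_upwards [hl.eventually_gt_atTop 0] with w hw
      simpa using hw
  obtain ⟨w₀, hw₀⟩ := Filter.eventually_atTop.1 (hs.eventually hev)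
  refine ⟨2 * Real.exp 2, by positivity, max w₀ 2, fun w hw => ?_⟩
  have hw2 : 2 ≤ w := le_trans (le_max_right _ _) hw
  have hlog : 0 < Real.log w := Real.log_pos (by exact_mod_cast hw2)
  have h1 := hw₀ w (le_trans (le_max_left _ _) hw)
  set η := (Real.log w)⁻¹ with hη
  have hη0 : 0 < η := inv_pos.2 hlog
  have hsum : Summable fun n : ℕ => (n : ℝ) ^ (-(1 + η)) :=
    Real.summable_nat_rpow.2 (by linarith)
  have hZ : ∑' n : ℕ, (n : ℝ) ^ (-(1 + η)) ≤ 2 * Real.log w := by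
    have e : ∑' n : ℕ, 1 / (n : ℝ) ^ (1 + η) = ∑' n : ℕ, (n : ℝ) ^ (-(1 + η)) :=
      tsum_congr fun n => by rw [Real.rpow_neg (Nat.cast_nonneg n), one_div]
    rw [e, add_sub_cancel_left, hη, inv_mul_le_iff₀ hlog] at h1
    linarith
  have hprod : ∏ p ∈ w.primesBelow, (1 - (p : ℝ) ^ (-(1 + η)))⁻¹ ≤ 2 * Real.log w := by
    have h := (EulerProduct.summable_and_hasSum_smoothNumbers_prod_primesBelow_geometric
      (f := rpowNegHom (1 + η)) (fun {p} hp => by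
        have : (1 : ℝ) < p := by exact_mod_cast hp.one_lt
        simp only [rpowNegHom, MonoidHom.coe_mk, OneHom.coe_mk]
        rw [Real.norm_of_nonneg (by positivity)]
        exact Real.rpow_lt_one_of_one_lt_of_neg this (by linarith)) w).2
    have h2 := h.tsum_eq
    simp only [rpowNegHom, MonoidHom.coe_mk, OneHom.coe_mk] at h2
    rw [← h2]
    refine le_trans ?_ hZ
    exact hsum.tsum_subtype_le (fun n : ℕ => (n : ℝ) ^ (-(1 + η))) _
      (fun n => by positivity)
  have hexp : Real.exp (∑ p ∈ w.primesBelow, (p : ℝ) ^ (-(1 + η))) ≤ 2 * Real.log w := by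
    refine le_trans ?_ hprod
    rw [Real.exp_sum]
    refine Finset.prod_le_prod (fun _ _ => (Real.exp_pos _).le) fun p hp => ?_
    have hp1 : (1 : ℝ) < p := by exact_mod_cast (Nat.prime_of_mem_primesBelow hp).one_lt
    have h3 : (p : ℝ) ^ (-(1 + η)) < 1 :=
      Real.rpow_lt_one_of_one_lt_of_neg hp1 (by linarith)
    rw [le_inv_comm₀ (Real.exp_pos _) (by linarith), ← Real.exp_neg]
    have := Real.add_one_le_exp (-(p : ℝ) ^ (-(1 + η)))
    linarith
  have hdiff : recipSum w ≤ ∑ p ∈ w.primesBelow, (p : ℝ) ^ (-(1 + η)) + 2 := by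
    have h4 : recipSum w ≤ ∑ p ∈ w.primesBelow,
        ((p : ℝ) ^ (-(1 + η)) + η * (Real.log p / p)) := by
      refine Finset.sum_le_sum fun p hp => ?_
      have hp0 : (0 : ℝ) < p := by exact_mod_cast (Nat.prime_of_mem_primesBelow hp).pos
      have h5 : (p : ℝ) ^ (-(1 + η)) = (p : ℝ)⁻¹ * Real.exp (-(Real.log p * η)) := by
        rw [neg_add, Real.rpow_add hp0, Real.rpow_neg_one, Real.rpow_def_of_pos hp0]
        ring_nf
      rw [h5]
      have h6 := Real.add_one_le_exp (-(Real.log p * η))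
      have h7 := mul_le_mul_of_nonneg_left h6 (inv_pos.2 hp0).le
      rw [div_eq_mul_inv]
      linarith
    rw [Finset.sum_add_distrib, ← Finset.mul_sum] at h4
    have h8 := mul_le_mul_of_nonneg_left (sum_log_div_le (by omega : 0 < w)) hη0.le
    have h9 : η * (2 * Real.log w) = 2 := by rw [hη]; field_simp
    linarith
  calc Real.exp (recipSum w) ≤ Real.exp (∑ p ∈ w.primesBelow, (p : ℝ) ^ (-(1 + η)) + 2) :=
        Real.exp_le_exp.2 hdiff
    _ = Real.exp (∑ p ∈ w.primesBelow, (p : ℝ) ^ (-(1 + η))) * Real.exp 2 := Real.exp_add _ _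
    _ ≤ 2 * Real.log w * Real.exp 2 := by gcongr
    _ = _ := by ring

lemma sum_inv_primeFactors_le (w : ℕ) {q T : ℕ} (hq : 0 < q) (hT : 0 < T) :
    ∑ p ∈ w.primesBelow with p ∣ q, (p : ℝ)⁻¹ ≤
      recipSum T + Real.log q / Real.log 2 / T := by
  have hcard : ((w.primesBelow.filter (· ∣ q)).card : ℝ) ≤ Real.log q / Real.log 2 := by
    have h1 : (w.primesBelow.filter (· ∣ q)).card ≤ q.primeFactors.card :=
      Finset.card_le_card fun p hp => by
        rw [Finset.mem_filter] at hp
        exact Nat.mem_primeFactors.2 ⟨Nat.prime_of_mem_primesBelow hp.1, hp.2, hq.ne'⟩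
    have h2 : 2 ^ q.primeFactors.card ≤ q :=
      (Finset.pow_card_le_prod _ _ _ fun p hp => (Nat.prime_of_mem_primeFactors hp).two_le).trans
        (Nat.le_of_dvd hq (Nat.prod_primeFactors_dvd q))
    have h3 : (2 : ℝ) ^ q.primeFactors.card ≤ q := by exact_mod_cast h2
    have h4 := Real.log_le_log (by positivity) h3
    rw [Real.log_pow] at h4
    rw [le_div_iff₀ (Real.log_pos one_lt_two)]
    refine le_trans ?_ h4
    have := (Real.log_pos one_lt_two).le
    gcongr
  have hT' : (0 : ℝ) < T := by exact_mod_cast hT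
  rw [← Finset.sum_filter_add_sum_filter_not (w.primesBelow.filter (· ∣ q)) (· < T)]
  refine add_le_add ?_ ?_
  · refine Finset.sum_le_sum_of_subset_of_nonneg (fun p hp => ?_) fun _ _ _ => by positivity
    simp only [Finset.mem_filter] at hp
    exact Nat.mem_primesBelow.2 ⟨hp.2, Nat.prime_of_mem_primesBelow hp.1.1⟩
  · calc ∑ p ∈ (w.primesBelow.filter (· ∣ q)).filter (¬ · < T), (p : ℝ)⁻¹
        ≤ ∑ p ∈ (w.primesBelow.filter (· ∣ q)).filter (¬ · < T), (T : ℝ)⁻¹ := by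
          refine Finset.sum_le_sum fun p hp => ?_
          have : T ≤ p := not_lt.1 (Finset.mem_filter.1 hp).2
          gcongr
      _ = ((w.primesBelow.filter (· ∣ q)).filter (¬ · < T)).card / T := by
          rw [Finset.sum_const, nsmul_eq_mul, div_eq_mul_inv]
      _ ≤ (w.primesBelow.filter (· ∣ q)).card / T := by
          gcongr
          exact Finset.filter_subset _ _
      _ ≤ _ := by gcongr

lemma sum_inv_smoothNumbers_le {w : ℕ} (hw : 8 ≤ w) {F : Finset ℕ}
    (hF : ∀ a ∈ F, a ∈ w.smoothNumbers) {Y : ℝ} (hY : 0 < Y) (hFY : ∀ a ∈ F, Y < a) :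
    ∑ a ∈ F, (a : ℝ)⁻¹ ≤ Y ^ (-(Real.log w)⁻¹) * Real.exp (12 * recipSum w) := by
  have hw' : (8 : ℝ) ≤ w := by exact_mod_cast hw
  have hlog : 2 ≤ Real.log w := by
    rw [Real.le_log_iff_exp_le (by linarith)]
    have h := Real.exp_one_lt_d9
    have : Real.exp 2 = Real.exp 1 * Real.exp 1 := by rw [← Real.exp_add]; norm_num
    rw [this]
    nlinarith [Real.exp_pos 1]
  set ε := (Real.log w)⁻¹ with hε
  have hε0 : 0 < ε := inv_pos.2 (by linarith)
  have hε1 : ε ≤ 1 / 2 := by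
    rw [hε, inv_le_comm₀ (by linarith) (by norm_num)]
    linarith
  have hf : ∀ p : ℕ, p.Prime → (p : ℝ) ^ (-(1 - ε)) ≤ 3 / 4 := by
    intro p hp
    have hp2 : (2 : ℝ) ≤ p := by exact_mod_cast hp.two_le
    calc (p : ℝ) ^ (-(1 - ε)) ≤ (p : ℝ) ^ (-(1 / 2) : ℝ) :=
          Real.rpow_le_rpow_of_exponent_le (by linarith) (by linarith)
      _ ≤ (2 : ℝ) ^ (-(1 / 2) : ℝ) :=
          Real.rpow_le_rpow_of_nonpos (by norm_num) hp2 (by norm_num)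
      _ ≤ 3 / 4 := by
          rw [Real.rpow_neg (by norm_num), ← Real.sqrt_eq_rpow, inv_le_comm₀
            (by positivity) (by norm_num)]
          exact Real.le_sqrt_of_sq_le (by norm_num)
  have h1 : ∑ a ∈ F, (a : ℝ) ^ (-(1 - ε)) ≤
      ∏ p ∈ w.primesBelow, (1 - (p : ℝ) ^ (-(1 - ε)))⁻¹ :=
    sum_smoothNumbers_le (f := rpowNegHom (1 - ε))
      (fun n => Real.rpow_nonneg (Nat.cast_nonneg n) _)
      (fun {p} hp => (hf p hp).trans_lt (by norm_num)) hF
  have h2 : ∏ p ∈ w.primesBelow, (1 - (p : ℝ) ^ (-(1 - ε)))⁻¹ ≤ Real.exp (12 * recipSum w) := by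
    rw [recipSum, Finset.mul_sum, Real.exp_sum]
    refine Finset.prod_le_prod (fun p hp => ?_) fun p hp => ?_
    · have := hf p (Nat.prime_of_mem_primesBelow hp)
      exact inv_nonneg.2 (by linarith)
    · have hp' := Nat.prime_of_mem_primesBelow hp
      have hp0 : (0 : ℝ) < p := by exact_mod_cast hp'.pos
      refine (inv_one_sub_le_exp_four_mul (by positivity) (hf p hp')).trans
        (Real.exp_le_exp.2 ?_)
      have h3 : (p : ℝ) ^ (-(1 - ε)) = (p : ℝ) ^ ε * (p : ℝ)⁻¹ := by
        rw [← Real.rpow_neg_one, ← Real.rpow_add hp0]; ring_nf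
      have h4 : (p : ℝ) ^ ε ≤ 3 := by
        calc (p : ℝ) ^ ε ≤ (w : ℝ) ^ ε := by
              have : p ≤ w := (Nat.lt_of_mem_primesBelow hp).le
              gcongr
          _ = Real.exp 1 := by
              rw [Real.rpow_def_of_pos (by linarith), hε, mul_inv_cancel₀ (by linarith)]
          _ ≤ 3 := Real.exp_one_lt_three.le
      rw [h3]
      have := inv_pos.2 hp0
      nlinarith
  calc ∑ a ∈ F, (a : ℝ)⁻¹ ≤ ∑ a ∈ F, Y ^ (-ε) * (a : ℝ) ^ (-(1 - ε)) := by
        refine Finset.sum_le_sum fun a ha => ?_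
        have ha0 : (0 : ℝ) < a := hY.trans (hFY a ha)
        have h3 : (a : ℝ)⁻¹ = (a : ℝ) ^ (-ε) * (a : ℝ) ^ (-(1 - ε)) := by
          rw [← Real.rpow_neg_one, ← Real.rpow_add ha0]; ring_nf
        rw [h3]
        refine mul_le_mul_of_nonneg_right ?_ (by positivity)
        exact Real.rpow_le_rpow_of_nonpos hY (hFY a ha).le (by linarith)
    _ = Y ^ (-ε) * ∑ a ∈ F, (a : ℝ) ^ (-(1 - ε)) := (Finset.mul_sum _ _ _).symm
    _ ≤ _ := by
        gcongr
        exact h1.trans h2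

/-- `w` is a sifting level which is admissible at height `X`: the sieve bounds for the integers
free of prime factors below `w`, and for the `w`-smooth numbers, hold with the constant `C`. -/
structure IsSiftingLevel (C X : ℝ) (w : ℕ) : Prop where
  level_le : (w : ℝ) ≤ X ^ (1 / 10 : ℝ)
  exp_recipSum_le : Real.exp (recipSum w) ≤ C * Real.log X
  count_rough_le : ∀ N : ℕ, X ^ (1 / 5 : ℝ) ≤ N →
    (Nat.count (fun b => ∀ p ∈ w.primesBelow, ¬ p ∣ b) N : ℝ) ≤
      C * N * (Real.log (Real.log X) / Real.log X)
  count_rough_and_shift_rough_le : ∀ q N : ℕ, 0 < q → (q : ℝ) ≤ X ^ 2 → X ^ (1 / 5 : ℝ) ≤ N →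
    (Nat.count (fun b => ∀ p ∈ w.primesBelow, ¬ (p ∣ b ∨ p ∣ q * b + 1)) N : ℝ) ≤
      C * N * (Real.log (Real.log X) ^ 3 / Real.log X ^ 2)
  sum_inv_smooth_le : ∀ F : Finset ℕ, (∀ a ∈ F, a ∈ w.smoothNumbers) →
    (∀ a ∈ F, X ^ (1 / 10 : ℝ) < a) → ∑ a ∈ F, (a : ℝ)⁻¹ ≤ C / Real.log X ^ 2

lemma exists_level (w₀ : ℕ) : ∃ X₀ : ℝ, ∀ X : ℝ, X₀ ≤ X → ∃ w k : ℕ, w₀ ≤ w ∧ Even k ∧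
    20 * Real.log (Real.log X) ≤ k ∧ (w : ℝ) ^ (2 * k) ≤ X ^ (1 / 10 : ℝ) ∧
    (w : ℝ) ≤ X ^ (1 / 10 : ℝ) ∧
    Real.log X ≤ 1000 * Real.log (Real.log X) * Real.log w ∧
    500 * Real.log (Real.log X) * Real.log w ≤ Real.log X := by
  set M : ℝ := |Real.log w₀| + 1 with hM
  have hM0 : 1 ≤ M := by
    have := abs_nonneg (Real.log w₀)
    linarith
  have hlog : Filter.Tendsto (fun X : ℝ => Real.log X) Filter.atTop Filter.atTop :=
    Real.tendsto_log_atTop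
  have hLL := (hlog.comp hlog).eventually_ge_atTop 2
  have ho : ∀ᶠ t : ℝ in Filter.atTop, ‖Real.log t‖ ≤ 1 / (1000 * M) * ‖t‖ :=
    Real.isLittleO_log_id_atTop.def (by positivity)
  have ho' := hlog.eventually ho
  obtain ⟨X₀, hX₀⟩ := Filter.eventually_atTop.1
    ((hLL.and ho').and (Filter.eventually_gt_atTop (1 : ℝ)))
  refine ⟨X₀, fun X hX => ?_⟩
  obtain ⟨⟨h1, h2⟩, h3⟩ := hX₀ X hX
  simp only [Function.comp_apply] at h1
  set L := Real.log X with hL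
  set LL := Real.log L with hLLd
  have hL0 : 0 < L := Real.log_pos h3
  have hX0 : 0 < X := by linarith
  rw [Real.norm_of_nonneg (by linarith), Real.norm_of_nonneg hL0.le, one_div,
    ← div_eq_inv_mul, le_div_iff₀ (by positivity)] at h2
  have hLL0 : 0 < LL := by linarith
  set u := L / (1000 * LL) with hu
  have hu1 : M ≤ u := by
    rw [hu, le_div_iff₀ (by positivity)]
    linarith
  have huL : u * (1000 * LL) = L := by rw [hu]; field_simp
  set w := ⌈Real.exp u⌉₊ with hw
  have hw1 : Real.exp u ≤ w := Nat.le_ceil _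
  have hw2 : (w : ℝ) ≤ Real.exp u * 2 := by
    have := (Nat.ceil_lt_add_one (Real.exp_pos u).le).le
    have h4 := Real.one_le_exp (by linarith : 0 ≤ u)
    linarith
  have hwpos : (0 : ℝ) < w := (Real.exp_pos u).trans_le hw1
  have hlw1 : u ≤ Real.log w := (Real.le_log_iff_exp_le hwpos).2 hw1
  have hlw2 : Real.log w ≤ 2 * u := by
    have h5 := Real.log_le_log hwpos hw2
    rw [Real.log_mul (Real.exp_pos u).ne' (by norm_num), Real.log_exp] at h5
    have := Real.log_two_lt_d9
    linarith
  have hkey : 500 * LL * Real.log w ≤ L := by nlinarith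
  have hX10 : X ^ (1 / 10 : ℝ) = Real.exp (L / 10) := by
    rw [Real.rpow_def_of_pos hX0, ← hL]; ring_nf
  refine ⟨w, 2 * ⌈10 * LL⌉₊, ?_, even_two_mul _, ?_, ?_, ?_, ?_, hkey⟩
  · rcases Nat.eq_zero_or_pos w₀ with rfl | h0
    · exact Nat.zero_le _
    have h0' : (0 : ℝ) < w₀ := by exact_mod_cast h0
    have h6 : Real.log w₀ ≤ Real.log w := by
      have := le_abs_self (Real.log w₀)
      linarith
    exact_mod_cast (Real.log_le_log_iff h0' hwpos).1 h6
  · push_cast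
    have := Nat.le_ceil (10 * LL)
    linarith
  · rw [hX10, ← Real.log_le_iff_le_exp (by positivity), Real.log_pow]
    push_cast
    have := (Nat.ceil_lt_add_one (by linarith : 0 ≤ 10 * LL)).le
    have h7 : 2 * (2 * (⌈10 * LL⌉₊ : ℝ)) ≤ 42 * LL := by linarith
    have := mul_le_mul_of_nonneg_right h7 (by linarith : 0 ≤ Real.log w)
    nlinarith
  · rw [hX10, ← Real.log_le_iff_le_exp hwpos]
    nlinarith
  · nlinarith

set_option maxHeartbeats 1600000 in
lemma exists_isSiftingLevel : ∃ C : ℝ, 1 ≤ C ∧ ∃ X₀ : ℝ, ∀ X : ℝ, X₀ ≤ X →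
    ∃ w : ℕ, IsSiftingLevel C X w := by
  obtain ⟨C₁, hC₁, w₀, hw₀⟩ := exp_recipSum_le_mul_log
  obtain ⟨X₁, hX₁⟩ := exists_level (max w₀ 8)
  set c := Real.exp (9 * invSqSum) with hc
  have hc0 : 0 < c := Real.exp_pos _
  have hlog : Filter.Tendsto (fun X : ℝ => Real.log X) Filter.atTop Filter.atTop :=
    Real.tendsto_log_atTop
  have hLL := (hlog.comp hlog).eventually_ge_atTop 1
  have hLw := hlog.eventually_ge_atTop ((w₀ : ℝ) + 2)
  have ho : ∀ᶠ t : ℝ in Filter.atTop, ‖Real.log t ^ (2 : ℝ)‖ ≤ 1 * ‖t ^ (1 / 10 : ℝ)‖ :=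
    (isLittleO_log_rpow_rpow_atTop 2 (by norm_num : (0 : ℝ) < 1 / 10)).def one_pos
  obtain ⟨X₂, hX₂⟩ := Filter.eventually_atTop.1
    ((hLL.and hLw).and (ho.and (Filter.eventually_gt_atTop (1 : ℝ))))
  set D := C₁ * 2 * Real.exp 3 with hD
  have hD0 : 0 < D := by positivity
  have hCle : ∀ y ∈ [1, C₁, 1000 * c + C₁ ^ 6 + 3, (1000 * c) ^ 2 * D + C₁ ^ 6 + 3, C₁ ^ 12],
      y ≤ 4 + C₁ + 1000 * c + (1000 * c) ^ 2 * D + C₁ ^ 6 + C₁ ^ 12 := by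
    have h1 : 0 < (1000 * c) ^ 2 * D := by positivity
    have h2 : 0 < C₁ ^ 6 := by positivity
    have h3 : 0 < C₁ ^ 12 := by positivity
    intro y hy
    simp only [List.mem_cons, List.not_mem_nil, or_false] at hy
    rcases hy with rfl | rfl | rfl | rfl | rfl <;> linarith
  refine ⟨_, hCle 1 (by simp), max X₁ X₂, fun X hX => ?_⟩
  generalize hC : 4 + C₁ + 1000 * c + (1000 * c) ^ 2 * D + C₁ ^ 6 + C₁ ^ 12 = C at hCle ⊢
  obtain ⟨w, k, hw, hk, hk20, hwk, hwX, hLw1, hLw2⟩ := hX₁ X ((le_max_left _ _).trans hX)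
  obtain ⟨⟨ht, hLw0⟩, hL10, hX1⟩ := hX₂ X ((le_max_right _ _).trans hX)
  simp only [Function.comp_apply] at ht
  have hw8 : 8 ≤ w := (le_max_right _ _).trans hw
  have hX0 : 0 < X := by linarith
  set L := Real.log X with hL
  set t := Real.log L with htL
  set S := recipSum w with hS
  have hL2 : 2 ≤ L := by
    have : (0 : ℝ) ≤ w₀ := Nat.cast_nonneg _
    linarith
  have hL0 : 0 < L := by linarith
  rw [Real.rpow_two, one_mul, Real.norm_of_nonneg (by positivity),
    Real.norm_of_nonneg (by positivity)] at hL10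
  have hlogw : 0 < Real.log w := Real.log_pos (by exact_mod_cast (by omega : 1 < w))
  have hexpt : Real.exp t = L := Real.exp_log hL0
  have e1 : Real.exp (-S) ≤ 1000 * c * (t / L) := by
    have h1 := log_le_exp_recipSum (by omega : 0 < w)
    rw [Real.exp_add, ← hc] at h1
    rw [Real.exp_neg, ← mul_div_assoc, inv_le_comm₀ (Real.exp_pos _) (by positivity), inv_div,
      div_le_iff₀ (by positivity)]
    nlinarith
  have e2 : Real.exp S ≤ C₁ * L := by
    refine (hw₀ w ((le_max_left _ _).trans hw)).trans ?_
    gcongr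
    nlinarith
  have e3 : Real.exp (-k) * L ^ 20 ≤ 1 := by
    rw [← hexpt, ← Real.exp_nat_mul, ← Real.exp_add, Real.exp_le_one_iff]
    push_cast
    linarith
  have e4 : Real.exp (-k + 6 * S) ≤ C₁ ^ 6 / L ^ 2 := by
    have h1 : Real.exp (6 * S) ≤ (C₁ * L) ^ 6 := by
      have : Real.exp (6 * S) = Real.exp S ^ 6 := by rw [← Real.exp_nat_mul]; norm_num
      rw [this]
      gcongr
    rw [Real.exp_add, le_div_iff₀ (by positivity)]
    calc Real.exp (-k) * Real.exp (6 * S) * L ^ 2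
        ≤ Real.exp (-k) * (C₁ * L) ^ 6 * L ^ 2 := by gcongr
      _ = C₁ ^ 6 * (Real.exp (-k) * L ^ 8) := by ring
      _ ≤ C₁ ^ 6 * (Real.exp (-k) * L ^ 20) := by
          gcongr
          · linarith
          · norm_num
      _ ≤ C₁ ^ 6 * 1 := by gcongr
      _ = _ := mul_one _
  have e5 : ∀ N : ℕ, X ^ (1 / 5 : ℝ) ≤ N → 3 * (w : ℝ) ^ (2 * k) ≤ N * (3 / L ^ 2) := by
    intro N hN
    have h1 : X ^ (1 / 5 : ℝ) = X ^ (1 / 10 : ℝ) * X ^ (1 / 10 : ℝ) := by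
      rw [← Real.rpow_add hX0]; norm_num
    rw [← mul_div_assoc, le_div_iff₀ (by positivity)]
    have h2 : (w : ℝ) ^ (2 * k) * L ^ 2 ≤ X ^ (1 / 10 : ℝ) * X ^ (1 / 10 : ℝ) := by gcongr
    linarith
  have f1 : 1 / L ^ 2 ≤ t / L := by
    rw [div_le_div_iff₀ (by positivity) hL0]
    nlinarith
  have f2 : 1 / L ^ 2 ≤ t ^ 3 / L ^ 2 := by
    gcongr
    exact one_le_pow₀ ht
  refine ⟨w, hwX, ?_, ?_, ?_, ?_⟩
  · exact e2.trans (mul_le_mul_of_nonneg_right (hCle _ (by simp)) hL0.le)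
  · intro N hN
    calc _ ≤ _ := count_rough_le (by omega : 0 < w) hk N
      _ ≤ N * (1000 * c * (t / L) + C₁ ^ 6 / L ^ 2) + N * (3 / L ^ 2) :=
          add_le_add (by gcongr) (e5 N hN)
      _ = N * (1000 * c * (t / L) + (C₁ ^ 6 + 3) * (1 / L ^ 2)) := by ring
      _ ≤ N * (1000 * c * (t / L) + (C₁ ^ 6 + 3) * (t / L)) := by gcongr
      _ = (1000 * c + C₁ ^ 6 + 3) * (N * (t / L)) := by ring
      _ ≤ C * (N * (t / L)) := mul_le_mul_of_nonneg_right (hCle _ (by simp)) (by positivity)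
      _ = _ := by ring
  · intro q N hq hqX hN
    have g1 : Real.exp (∑ p ∈ w.primesBelow with p ∣ q, (p : ℝ)⁻¹) ≤ D * t := by
      set T := ⌈L⌉₊ with hT
      have hLT : L ≤ T := Nat.le_ceil L
      have hT0 : (0 : ℝ) < T := hL0.trans_le hLT
      have hTw : w₀ ≤ T := by
        have : (w₀ : ℝ) ≤ T := by linarith
        exact_mod_cast this
      have h1 := sum_inv_primeFactors_le w hq (by exact_mod_cast hT0 : 0 < T)
      have h2 : Real.log q / Real.log 2 / T ≤ 3 := by
        have h3 := Real.log_le_log (by exact_mod_cast hq) hqX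
        rw [Real.log_pow] at h3
        push_cast at h3
        have h4 := Real.log_two_gt_d9
        rw [div_le_iff₀ hT0, div_le_iff₀ (by linarith)]
        nlinarith
      have h5 : Real.log T ≤ 2 * t := by
        have h6 : (T : ℝ) ≤ L ^ 2 := by
          have := (Nat.ceil_lt_add_one hL0.le).le
          nlinarith
        have h7 := Real.log_le_log hT0 h6
        rw [Real.log_pow] at h7
        exact_mod_cast h7
      calc _ ≤ Real.exp (recipSum T + 3) := Real.exp_le_exp.2 (by linarith)
        _ = Real.exp (recipSum T) * Real.exp 3 := Real.exp_add _ _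
        _ ≤ C₁ * (2 * t) * Real.exp 3 := by
            gcongr
            exact (hw₀ T hTw).trans (by gcongr)
        _ = _ := by rw [hD]; ring
    have g2 : Real.exp (-2 * S + ∑ p ∈ w.primesBelow with p ∣ q, (p : ℝ)⁻¹) ≤
        (1000 * c * (t / L)) ^ 2 * (D * t) := by
      have : Real.exp (-2 * S) = Real.exp (-S) ^ 2 := by
        rw [← Real.exp_nat_mul]; push_cast; ring_nf
      rw [Real.exp_add, this]
      gcongr
    calc _ ≤ _ := _root_.count_rough_and_shift_rough_le (by omega : 0 < w) hk q N
      _ ≤ N * ((1000 * c * (t / L)) ^ 2 * (D * t) + C₁ ^ 6 / L ^ 2) + N * (3 / L ^ 2) :=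
          add_le_add (by gcongr) (e5 N hN)
      _ = N * ((1000 * c) ^ 2 * D * (t ^ 3 / L ^ 2) + (C₁ ^ 6 + 3) * (1 / L ^ 2)) := by ring
      _ ≤ N * ((1000 * c) ^ 2 * D * (t ^ 3 / L ^ 2) + (C₁ ^ 6 + 3) * (t ^ 3 / L ^ 2)) := by
          gcongr
      _ = ((1000 * c) ^ 2 * D + C₁ ^ 6 + 3) * (N * (t ^ 3 / L ^ 2)) := by ring
      _ ≤ C * (N * (t ^ 3 / L ^ 2)) :=
          mul_le_mul_of_nonneg_right (hCle _ (by simp)) (by positivity)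
      _ = _ := by ring
  · intro F hF hFX
    have h1 : (X ^ (1 / 10 : ℝ)) ^ (-(Real.log w)⁻¹) * L ^ 50 ≤ 1 := by
      rw [← Real.rpow_mul hX0.le, Real.rpow_def_of_pos hX0, ← hexpt, ← Real.exp_nat_mul,
        ← Real.exp_add, Real.exp_le_one_iff, ← hL]
      have : 500 * t ≤ L * (Real.log w)⁻¹ := by
        rw [← div_eq_mul_inv, le_div_iff₀ hlogw]
        exact hLw2
      push_cast
      linarith
    have h2 : Real.exp (12 * S) ≤ (C₁ * L) ^ 12 := by
      have : Real.exp (12 * S) = Real.exp S ^ 12 := by rw [← Real.exp_nat_mul]; norm_num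
      rw [this]
      gcongr
    set Z := (X ^ (1 / 10 : ℝ)) ^ (-(Real.log w)⁻¹) with hZ
    have hZ0 : 0 ≤ Z := by positivity
    calc _ ≤ Z * Real.exp (12 * S) :=
          sum_inv_smoothNumbers_le hw8 hF (by positivity) hFX
      _ ≤ C₁ ^ 12 / L ^ 2 := by
          rw [le_div_iff₀ (by positivity)]
          calc Z * Real.exp (12 * S) * L ^ 2 ≤ Z * (C₁ * L) ^ 12 * L ^ 2 := by gcongr
            _ = C₁ ^ 12 * (Z * L ^ 14) := by ring
            _ ≤ C₁ ^ 12 * (Z * L ^ 50) := by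
                gcongr
                · linarith
                · norm_num
            _ ≤ C₁ ^ 12 * 1 := by gcongr
            _ = _ := mul_one _
      _ ≤ C / L ^ 2 := by
          gcongr
          exact hCle _ (by simp)

lemma exists_smooth_mul_rough (w : ℕ) {n : ℕ} (hn : n ≠ 0) : ∃ a b : ℕ, n = a * b ∧
    a ∈ w.smoothNumbers ∧ ∀ p ∈ w.primesBelow, ¬ p ∣ b := by
  have hprime : ∀ p ∈ n.primeFactorsList.filter (fun p => !decide (p < w)), p.Prime := fun p hp =>
    Nat.prime_of_mem_primeFactorsList (List.mem_of_mem_filter hp)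
  refine ⟨(n.primeFactorsList.filter (· < w)).prod,
    (n.primeFactorsList.filter (fun p => !decide (p < w))).prod,
    ?_, Nat.prod_mem_smoothNumbers n w, fun p hp hdvd => ?_⟩
  · have := (List.filter_append_perm (· < w) n.primeFactorsList).prod_eq
    rw [List.prod_append, Nat.prod_primeFactorsList hn] at this
    exact this.symm
  · obtain ⟨r, hr, hpr⟩ := (Nat.prime_of_mem_primesBelow hp).prime.dvd_prod_iff.1 hdvd
    have hpr' := (Nat.prime_dvd_prime_iff_eq (Nat.prime_of_mem_primesBelow hp) (hprime r hr)).1 hpr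
    have h1 := Nat.lt_of_mem_primesBelow hp
    have h2 := (List.mem_filter.1 hr).2
    simp at h2
    omega

lemma sum_inv_le_of_dyadic {T : Finset ℕ} {A Y : ℝ} (hY : 0 < Y)
    (hT : ∀ t : ℝ, Y ≤ t → ((T.filter fun b : ℕ => (b : ℝ) < 2 * t).card : ℝ) ≤ A * t) (J : ℕ)
    (hTY : ∀ b ∈ T, Y ≤ (b : ℝ)) (hTJ : ∀ b ∈ T, (b : ℝ) < 2 ^ J * Y) :
    ∑ b ∈ T, (b : ℝ)⁻¹ ≤ J * A := by
  induction J generalizing T with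
  | zero =>
    have : T = ∅ := Finset.eq_empty_of_forall_notMem fun b hb => by
      have h1 := hTY b hb
      have h2 := hTJ b hb
      linarith
    simp [this]
  | succ J ih =>
    have hJ : (0 : ℝ) < 2 ^ J * Y := by positivity
    rw [← Finset.sum_filter_add_sum_filter_not T fun b : ℕ => (b : ℝ) < 2 ^ J * Y]
    have h1 : ∑ b ∈ T.filter (fun b : ℕ => (b : ℝ) < 2 ^ J * Y), (b : ℝ)⁻¹ ≤ J * A := by
      refine ih (fun t ht => le_trans ?_ (hT t ht))
        (fun b hb => hTY b (Finset.mem_filter.1 hb).1) fun b hb => (Finset.mem_filter.1 hb).2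
      gcongr
      exact Finset.filter_subset _ _
    have h2 : ∑ b ∈ T.filter (fun b : ℕ => ¬ (b : ℝ) < 2 ^ J * Y), (b : ℝ)⁻¹ ≤ A := by
      calc ∑ b ∈ T.filter (fun b : ℕ => ¬ (b : ℝ) < 2 ^ J * Y), (b : ℝ)⁻¹
          ≤ ∑ b ∈ T.filter (fun b : ℕ => ¬ (b : ℝ) < 2 ^ J * Y), (2 ^ J * Y)⁻¹ := by
            refine Finset.sum_le_sum fun b hb => ?_
            have := not_lt.1 (Finset.mem_filter.1 hb).2
            gcongr
        _ = (T.filter fun b : ℕ => ¬ (b : ℝ) < 2 ^ J * Y).card / (2 ^ J * Y) := by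
            rw [Finset.sum_const, nsmul_eq_mul, div_eq_mul_inv]
        _ ≤ A := by
            rw [div_le_iff₀ hJ]
            refine le_trans ?_ (hT (2 ^ J * Y) (le_mul_of_one_le_left hY.le
              (one_le_pow₀ one_le_two)))
            refine Nat.cast_le.2 (Finset.card_le_card fun b hb => ?_)
            refine Finset.mem_filter.2 ⟨(Finset.mem_filter.1 hb).1, ?_⟩
            have := hTJ b (Finset.mem_filter.1 hb).1
            rw [pow_succ] at this
            linarith
    push_cast
    linarith

lemma card_le_sum_mul_card {ι : Type*} {E : Finset ℕ} {I : Finset ι} {S : ι → Finset ℕ}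
    {g : ι → ℝ} (hg : ∀ i ∈ I, 0 ≤ g i) (h : ∀ p ∈ E, ∃ i ∈ I, p ∈ S i ∧ 1 ≤ g i) :
    (E.card : ℝ) ≤ ∑ i ∈ I, g i * (S i).card := by
  classical
  have h1 : E ⊆ (I.filter fun i => 1 ≤ g i).biUnion S := fun p hp => by
    obtain ⟨i, hi, hpi, hgi⟩ := h p hp
    exact Finset.mem_biUnion.2 ⟨i, Finset.mem_filter.2 ⟨hi, hgi⟩, hpi⟩
  calc (E.card : ℝ) ≤ ∑ i ∈ I with 1 ≤ g i, ((S i).card : ℝ) := by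
        exact_mod_cast (Finset.card_le_card h1).trans Finset.card_biUnion_le
    _ ≤ ∑ i ∈ I with 1 ≤ g i, g i * (S i).card := by
        refine Finset.sum_le_sum fun i hi => ?_
        exact le_mul_of_one_le_left (Nat.cast_nonneg _) (Finset.mem_filter.1 hi).2
    _ ≤ _ := Finset.sum_le_sum_of_subset_of_nonneg (Finset.filter_subset _ _) fun i hi _ =>
        mul_nonneg (hg i hi) (Nat.cast_nonneg _)

/-- The real number `X` is large enough for the elementary comparisons between `X` and its
logarithms. -/
structure IsLarge (X : ℝ) : Prop where
  one_lt : 1 < X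
  one_le_log_log : 1 ≤ Real.log (Real.log X)
  log_sq_le : Real.log X ^ 2 ≤ X ^ (1 / 10 : ℝ)

lemma eventually_isLarge : ∀ᶠ X : ℝ in Filter.atTop, IsLarge X := by
  have hlog : Filter.Tendsto (fun X : ℝ => Real.log X) Filter.atTop Filter.atTop :=
    Real.tendsto_log_atTop
  have ho : ∀ᶠ t : ℝ in Filter.atTop, ‖Real.log t ^ (2 : ℝ)‖ ≤ 1 * ‖t ^ (1 / 10 : ℝ)‖ :=
    (isLittleO_log_rpow_rpow_atTop 2 (by norm_num : (0 : ℝ) < 1 / 10)).def one_pos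
  filter_upwards [(hlog.comp hlog).eventually_ge_atTop 1, ho, Filter.eventually_gt_atTop (1 : ℝ)]
    with X h1 h2 h3
  refine ⟨h3, h1, ?_⟩
  have : 0 < X := by linarith
  rwa [Real.rpow_two, one_mul, Real.norm_of_nonneg (by positivity),
    Real.norm_of_nonneg (by positivity)] at h2

namespace IsLarge

variable {X : ℝ}

lemma pos (h : IsLarge X) : 0 < X := zero_lt_one.trans h.one_lt

lemma two_le_log (h : IsLarge X) : 2 ≤ Real.log X := by
  have h0 := Real.log_pos h.one_lt
  have h1 := (Real.le_log_iff_exp_le h0).1 h.one_le_log_log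
  have := Real.add_one_le_exp 1
  linarith

lemma four_le (h : IsLarge X) : 4 ≤ X ^ (1 / 10 : ℝ) := by
  have h1 := h.two_le_log
  have h2 := h.log_sq_le
  nlinarith

lemma log_le (h : IsLarge X) : Real.log X ≤ X ^ (1 / 10 : ℝ) := by
  have h1 := h.two_le_log
  have h2 := h.log_sq_le
  nlinarith

lemma pow_ten (h : IsLarge X) : (X ^ (1 / 10 : ℝ)) ^ 10 = X := by
  rw [← Real.rpow_natCast, ← Real.rpow_mul h.pos.le]; norm_num

lemma pow_five (h : IsLarge X) : (X ^ (1 / 10 : ℝ)) ^ 5 = √X := by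
  rw [← Real.rpow_natCast, ← Real.rpow_mul h.pos.le, Real.sqrt_eq_rpow]; norm_num

lemma pow_two (h : IsLarge X) : (X ^ (1 / 10 : ℝ)) ^ 2 = X ^ (1 / 5 : ℝ) := by
  rw [← Real.rpow_natCast, ← Real.rpow_mul h.pos.le]; norm_num

end IsLarge

/-- The primes in `[w, 2X]`. -/
noncomputable def largePrimes (X : ℝ) (w : ℕ) : Finset ℕ :=
  (Finset.range (⌊2 * X⌋₊ + 1)).filter fun p => p.Prime ∧ w ≤ p

lemma mem_largePrimes {X : ℝ} (hX : 0 ≤ X) {w p : ℕ} :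
    p ∈ largePrimes X w ↔ (p : ℝ) ≤ 2 * X ∧ p.Prime ∧ w ≤ p := by
  rw [largePrimes, Finset.mem_filter, Finset.mem_range, Nat.lt_succ_iff,
    Nat.le_floor_iff (by positivity)]

open Classical in
/-- The primes in `[w, 2X]` of the form `q * b + 1` with `b` free of prime factors below `w`. -/
noncomputable def progressionPrimes (X : ℝ) (w q : ℕ) : Finset ℕ :=
  (largePrimes X w).filter fun p => ∃ b, p = q * b + 1 ∧ ∀ r ∈ w.primesBelow, ¬ r ∣ b

lemma card_progressionPrimes_le {C X : ℝ} {w : ℕ} (h : IsSiftingLevel C X w) (hX : IsLarge X)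
    (hC : 0 ≤ C) {q : ℕ} (hq : 0 < q) (hqX : (q : ℝ) ≤ 2 * (X ^ (1 / 10 : ℝ)) ^ 7) :
    ((progressionPrimes X w q).card : ℝ) ≤
      C * (3 * X / q) * (Real.log (Real.log X) ^ 3 / Real.log X ^ 2) := by
  classical
  have hX0 := hX.pos
  have hq0 : (0 : ℝ) < q := by exact_mod_cast hq
  have hx4 := hX.four_le
  have hx10 := hX.pow_ten
  have hx2 := hX.pow_two
  set x := X ^ (1 / 10 : ℝ) with hx
  have hqx8 : (q : ℝ) ≤ x ^ 8 := by
    have : 0 ≤ x ^ 7 := by positivity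
    nlinarith
  have hqX' : (q : ℝ) ≤ X := by
    rw [← hx10]
    exact hqx8.trans (pow_le_pow_right₀ (by linarith) (by norm_num))
  set N := ⌊2 * X / q⌋₊ + 1 with hN
  have hN1 : 2 * X / q ≤ N := by
    rw [hN]
    exact_mod_cast (Nat.lt_floor_add_one _).le
  have hN2 : (N : ℝ) ≤ 3 * X / q := by
    have h1 : (N : ℝ) ≤ 2 * X / q + 1 := by
      rw [hN]
      push_cast
      gcongr
      exact Nat.floor_le (by positivity)
    have h2 : 1 ≤ X / q := by rwa [le_div_iff₀ hq0, one_mul]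
    have h3 : 3 * X / q = 2 * X / q + X / q := by ring
    linarith
  have hsub : progressionPrimes X w q ⊆ ((Finset.range N).filter fun b =>
      ∀ r ∈ w.primesBelow, ¬ (r ∣ b ∨ r ∣ q * b + 1)).image fun b => q * b + 1 := by
    intro p hp
    rw [progressionPrimes, Finset.mem_filter, mem_largePrimes hX0.le] at hp
    obtain ⟨⟨hp1, hp2, hp3⟩, b, rfl, hb⟩ := hp
    refine Finset.mem_image.2 ⟨b, Finset.mem_filter.2 ⟨?_, fun r hr => ?_⟩, rfl⟩
    · rw [Finset.mem_range, hN, Nat.lt_succ_iff, Nat.le_floor_iff (by positivity),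
        le_div_iff₀ hq0]
      push_cast at hp1
      linarith
    · rintro (h1 | h1)
      · exact hb r hr h1
      · have h2 := (Nat.prime_dvd_prime_iff_eq (Nat.prime_of_mem_primesBelow hr) hp2).1 h1
        have h3 := Nat.lt_of_mem_primesBelow hr
        omega
  calc ((progressionPrimes X w q).card : ℝ)
      ≤ Nat.count (fun b => ∀ r ∈ w.primesBelow, ¬ (r ∣ b ∨ r ∣ q * b + 1)) N := by
        rw [Nat.count_eq_card_filter_range]
        exact_mod_cast (Finset.card_le_card hsub).trans Finset.card_image_le
    _ ≤ C * N * (Real.log (Real.log X) ^ 3 / Real.log X ^ 2) := by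
        refine h.count_rough_and_shift_rough_le q N hq ?_ ?_
        · nlinarith [hX.one_lt]
        · rw [← hx2]
          refine le_trans ?_ hN1
          rw [le_div_iff₀ hq0]
          calc x ^ 2 * q ≤ x ^ 2 * x ^ 8 := by gcongr
            _ = X := by rw [← hx10]; ring
            _ ≤ 2 * X := by linarith
    _ ≤ _ := by
        have := hX.one_le_log_log
        gcongr

open Classical in
/-- The `w`-smooth numbers up to `X ^ (1 / 10)`. -/
noncomputable def smallSmooth (X : ℝ) (w : ℕ) : Finset ℕ :=
  (Finset.range (⌊X ^ (1 / 10 : ℝ)⌋₊ + 1)).filter (· ∈ w.smoothNumbers)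

lemma mem_smallSmooth {X : ℝ} (hX : 0 ≤ X) {w a : ℕ} :
    a ∈ smallSmooth X w ↔ (a : ℝ) ≤ X ^ (1 / 10 : ℝ) ∧ a ∈ w.smoothNumbers := by
  rw [smallSmooth, Finset.mem_filter, Finset.mem_range, Nat.lt_succ_iff,
    Nat.le_floor_iff (by positivity)]

lemma sum_smallSmooth_le {C X : ℝ} {w : ℕ} (h : IsSiftingLevel C X w) (hX : IsLarge X)
    {z : ℝ} (hz : 0 ≤ z) (hz' : z ≤ 3 / 2) :
    ∑ a ∈ smallSmooth X w, z ^ ArithmeticFunction.cardFactors a / a ≤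
      Real.exp (9 * invSqSum) * (C * Real.log X) ^ z := by
  refine (sum_pow_cardFactors_div_le (w := w) hz hz'
    fun a ha => ((mem_smallSmooth hX.pos.le).1 ha).2).trans ?_
  rw [add_comm, Real.exp_add, mul_comm z, Real.exp_mul (recipSum w)]
  exact mul_le_mul_of_nonneg_left
    (Real.rpow_le_rpow (Real.exp_pos _).le h.exp_recipSum_le hz) (Real.exp_pos _).le

lemma card_large_smooth_part_le {C X : ℝ} {w : ℕ} (h : IsSiftingLevel C X w) (hX : IsLarge X)
    {E : Finset ℕ} (hE : ∀ p ∈ E, 2 ≤ p ∧ (p : ℝ) ≤ 2 * X ∧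
      ∃ a b : ℕ, p - 1 = a * b ∧ a ∈ w.smoothNumbers ∧ X ^ (1 / 10 : ℝ) < a) :
    (E.card : ℝ) ≤ 2 * C * (X / Real.log X ^ 2) := by
  classical
  have hX0 := hX.pos
  set F := (Finset.range (⌊2 * X⌋₊ + 1)).filter fun a : ℕ =>
    a ∈ w.smoothNumbers ∧ X ^ (1 / 10 : ℝ) < a with hF
  have h1 : (E.card : ℝ) ≤ ∑ a ∈ F, (1 : ℝ) *
      ((Finset.Icc 1 ⌊2 * X / a⌋₊).image fun b => a * b + 1).card := by
    refine card_le_sum_mul_card (fun _ _ => zero_le_one) fun p hp => ?_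
    obtain ⟨hp2, hpX, a, b, hab, ha, haX⟩ := hE p hp
    have hp' : p = a * b + 1 := by omega
    have hb : 1 ≤ b := by
      rcases Nat.eq_zero_or_pos b with rfl | hb
      · simp at hab; omega
      · exact hb
    have ha0 : (0 : ℝ) < a := lt_of_le_of_lt (by positivity) haX
    have hb' : (1 : ℝ) ≤ b := by exact_mod_cast hb
    rw [hp'] at hpX
    push_cast at hpX
    refine ⟨a, Finset.mem_filter.2 ⟨?_, ha, haX⟩, Finset.mem_image.2 ⟨b, ?_, hp'.symm⟩, le_rfl⟩
    · rw [Finset.mem_range, Nat.lt_succ_iff, Nat.le_floor_iff (by positivity)]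
      nlinarith
    · rw [Finset.mem_Icc, Nat.le_floor_iff (by positivity), le_div_iff₀ ha0]
      exact ⟨hb, by linarith⟩
  calc (E.card : ℝ) ≤ _ := h1
    _ ≤ ∑ a ∈ F, 2 * X * (a : ℝ)⁻¹ := by
        refine Finset.sum_le_sum fun a _ => ?_
        rw [one_mul, ← div_eq_mul_inv]
        refine le_trans ?_ (Nat.floor_le (by positivity))
        refine Nat.cast_le.2 (Finset.card_image_le.trans ?_)
        simp
    _ = 2 * X * ∑ a ∈ F, (a : ℝ)⁻¹ := (Finset.mul_sum _ _ _).symm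
    _ ≤ 2 * X * (C / Real.log X ^ 2) := by
        gcongr
        exact h.sum_inv_smooth_le F (fun a ha => (Finset.mem_filter.1 ha).2.1)
          fun a ha => (Finset.mem_filter.1 ha).2.2
    _ = _ := by ring

lemma card_many_prime_factors_le {C X : ℝ} {w : ℕ} (h : IsSiftingLevel C X w) (hX : IsLarge X)
    (hC : 0 ≤ C) {z K : ℝ} (hz : 1 ≤ z) (hz' : z ≤ 3 / 2) {E : Finset ℕ}
    (hE : ∀ p ∈ E, ∃ a ∈ smallSmooth X w, p ∈ progressionPrimes X w a ∧
      K ≤ ArithmeticFunction.cardFactors a) :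
    (E.card : ℝ) ≤ 3 * C * Real.exp (9 * invSqSum) *
      (X * (Real.log (Real.log X) ^ 3 / Real.log X ^ 2) * (z ^ (-K) * (C * Real.log X) ^ z)) := by
  have hX0 := hX.pos
  have hz0 : 0 < z := by linarith
  have ht := hX.one_le_log_log
  have hL := hX.two_le_log
  set W := Real.log (Real.log X) ^ 3 / Real.log X ^ 2 with hW
  have hW0 : 0 ≤ W := by positivity
  calc (E.card : ℝ)
      ≤ ∑ a ∈ smallSmooth X w, z ^ (-K) * z ^ ArithmeticFunction.cardFactors a *
          (progressionPrimes X w a).card := by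
        refine card_le_sum_mul_card (fun _ _ => by positivity) fun p hp => ?_
        obtain ⟨a, ha, hpa, hK⟩ := hE p hp
        refine ⟨a, ha, hpa, ?_⟩
        rw [← Real.rpow_natCast, ← Real.rpow_add hz0]
        exact Real.one_le_rpow hz (by linarith)
    _ ≤ ∑ a ∈ smallSmooth X w, 3 * C * X * W * z ^ (-K) *
          (z ^ ArithmeticFunction.cardFactors a / a) := by
        refine Finset.sum_le_sum fun a ha => ?_
        obtain ⟨ha1, ha2⟩ := (mem_smallSmooth hX0.le).1 ha
        have ha3 : (a : ℝ) ≤ 2 * (X ^ (1 / 10 : ℝ)) ^ 7 := by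
          have h4 := hX.four_le
          have := le_self_pow₀ (by linarith : 1 ≤ X ^ (1 / 10 : ℝ)) (by norm_num : 7 ≠ 0)
          linarith
        calc _ ≤ z ^ (-K) * z ^ ArithmeticFunction.cardFactors a * (C * (3 * X / a) * W) := by
              gcongr
              exact card_progressionPrimes_le h hX hC
                (Nat.pos_of_ne_zero (Nat.ne_zero_of_mem_smoothNumbers ha2)) ha3
          _ = _ := by ring
    _ = 3 * C * X * W * z ^ (-K) * ∑ a ∈ smallSmooth X w,
          z ^ ArithmeticFunction.cardFactors a / a := (Finset.mul_sum _ _ _).symm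
    _ ≤ 3 * C * X * W * z ^ (-K) * (Real.exp (9 * invSqSum) * (C * Real.log X) ^ z) := by
        gcongr
        exact sum_smallSmooth_le h hX hz0.le hz'
    _ = _ := by ring

open Classical in
/-- The integers `b` free of prime factors below `w` for which `a * b` lies in the interval
`[√X / log X, 2 √X log X]`. -/
noncomputable def roughCofactors (X : ℝ) (w a : ℕ) : Finset ℕ :=
  (Finset.range (⌊2 * √X * Real.log X⌋₊ + 1)).filter fun b => (∀ r ∈ w.primesBelow, ¬ r ∣ b) ∧
    √X / Real.log X ≤ a * b ∧ (a * b : ℝ) ≤ 2 * √X * Real.log X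

lemma sum_roughCofactors_le {C X : ℝ} {w : ℕ} (h : IsSiftingLevel C X w) (hX : IsLarge X)
    (hC : 0 ≤ C) {a : ℕ} (ha : a ∈ smallSmooth X w) :
    ∑ b ∈ roughCofactors X w a, (b : ℝ)⁻¹ ≤
      18 * C * (Real.log (Real.log X) ^ 2 / Real.log X) := by
  obtain ⟨ha1, ha2⟩ := (mem_smallSmooth hX.pos.le).1 ha
  have ha0 : (0 : ℝ) < a := by
    exact_mod_cast Nat.pos_of_ne_zero (Nat.ne_zero_of_mem_smoothNumbers ha2)
  have hX0 := hX.pos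
  have ht := hX.one_le_log_log
  have hL := hX.two_le_log
  have hLx := hX.log_le
  have hx4 := hX.four_le
  have hx5 := hX.pow_five
  have hx2 := hX.pow_two
  set x := X ^ (1 / 10 : ℝ) with hx
  set L := Real.log X with hLd
  set t := Real.log L with htd
  have hL0 : 0 < L := by linarith
  set Y := √X / (L * a) with hY
  have hY2 : X ^ (1 / 5 : ℝ) ≤ Y := by
    rw [← hx2, hY, le_div_iff₀ (by positivity), ← hx5]
    calc x ^ 2 * (L * a) ≤ x ^ 2 * (x * x) := by gcongr
      _ = x ^ 4 := by ring
      _ ≤ x ^ 5 := pow_le_pow_right₀ (by linarith) (by norm_num)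
  have hY1 : 1 ≤ Y := by
    refine le_trans ?_ hY2
    rw [← hx2]
    exact one_le_pow₀ (by linarith)
  set J := ⌈5 * t⌉₊ with hJ
  have hJ1 : (J : ℝ) ≤ 6 * t := by
    have := (Nat.ceil_lt_add_one (by linarith : 0 ≤ 5 * t)).le
    linarith
  have hJ2 : 2 * L ^ 2 < 2 ^ J := by
    rw [← Real.log_lt_log_iff (by positivity) (by positivity), Real.log_pow,
      Real.log_mul (by norm_num) (by positivity), Real.log_pow]
    have h1 := Nat.le_ceil (5 * t)
    have h2 := Real.log_two_gt_d9
    have h3 := Real.log_two_lt_d9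
    push_cast
    nlinarith
  have hdy := sum_inv_le_of_dyadic (T := roughCofactors X w a) (A := 3 * C * (t / L)) (Y := Y)
    (by linarith) (fun s hs => ?_) J (fun b hb => ?_) fun b hb => ?_
  · calc _ ≤ _ := hdy
      _ ≤ 6 * t * (3 * C * (t / L)) := by gcongr
      _ = _ := by ring
  · have hs1 : 1 ≤ s := hY1.trans hs
    calc (((roughCofactors X w a).filter fun b : ℕ => (b : ℝ) < 2 * s).card : ℝ)
        ≤ Nat.count (fun b => ∀ r ∈ w.primesBelow, ¬ r ∣ b) ⌈2 * s⌉₊ := by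
          rw [Nat.count_eq_card_filter_range]
          gcongr
          intro b hb
          rw [Finset.mem_filter, roughCofactors, Finset.mem_filter] at hb
          exact Finset.mem_filter.2 ⟨Finset.mem_range.2 (Nat.lt_ceil.2 hb.2), hb.1.2.1⟩
      _ ≤ C * ⌈2 * s⌉₊ * (t / L) := by
          refine h.count_rough_le _ ?_
          have := Nat.le_ceil (2 * s)
          linarith
      _ ≤ C * (3 * s) * (t / L) := by
          have := (Nat.ceil_lt_add_one (by linarith : 0 ≤ 2 * s)).le
          gcongr
          linarith
      _ = _ := by ring
  · rw [roughCofactors, Finset.mem_filter] at hb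
    rw [hY, ← div_div, div_le_iff₀ ha0]
    linarith [hb.2.2.1]
  · rw [roughCofactors, Finset.mem_filter] at hb
    have h1 : 0 < √X := Real.sqrt_pos.2 hX0
    have h2 : 2 ^ J * Y = 2 ^ J * √X / L / a := by rw [hY]; field_simp
    rw [h2, lt_div_iff₀ ha0, lt_div_iff₀ hL0]
    calc (b : ℝ) * a * L = a * b * L := by ring
      _ ≤ 2 * √X * L * L := mul_le_mul_of_nonneg_right hb.2.2.2 hL0.le
      _ = 2 * L ^ 2 * √X := by ring
      _ < _ := by gcongr

lemma card_few_prime_factors_le {C X : ℝ} {w : ℕ} (h : IsSiftingLevel C X w) (hX : IsLarge X)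
    (hC : 0 ≤ C) {z K : ℝ} (hz : 0 < z) (hz' : z ≤ 1) {E : Finset ℕ}
    (hE : ∀ p ∈ E, ∃ a ∈ smallSmooth X w, ∃ a' ∈ smallSmooth X w, ∃ b ∈ roughCofactors X w a,
      p ∈ progressionPrimes X w (a * a' * b) ∧
      (ArithmeticFunction.cardFactors a + ArithmeticFunction.cardFactors a' : ℝ) ≤ K) :
    (E.card : ℝ) ≤ 54 * C ^ 2 * Real.exp (9 * invSqSum) ^ 2 *
      (X * (Real.log (Real.log X) ^ 5 / Real.log X ^ 3) *
        (z ^ (-K) * ((C * Real.log X) ^ z) ^ 2)) := by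
  have hX0 := hX.pos
  have ht := hX.one_le_log_log
  have hL := hX.two_le_log
  set W := Real.log (Real.log X) ^ 3 / Real.log X ^ 2 with hW
  have hW0 : 0 ≤ W := by positivity
  set F := smallSmooth X w with hF
  set f : ℕ → ℝ := fun a => z ^ ArithmeticFunction.cardFactors a / a with hf
  have hf0 : ∀ a, 0 ≤ f a := fun a => by positivity
  set V := 18 * C * (Real.log (Real.log X) ^ 2 / Real.log X) with hV
  calc (E.card : ℝ)
      ≤ ∑ i ∈ (F ×ˢ F).sigma fun i => roughCofactors X w i.1,
          z ^ (-K) * z ^ ArithmeticFunction.cardFactors i.1.1 *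
            z ^ ArithmeticFunction.cardFactors i.1.2 *
          (progressionPrimes X w (i.1.1 * i.1.2 * i.2)).card := by
        refine card_le_sum_mul_card (fun _ _ => by positivity) fun p hp => ?_
        obtain ⟨a, ha, a', ha', b, hb, hpa, hK⟩ := hE p hp
        refine ⟨⟨(a, a'), b⟩, Finset.mem_sigma.2 ⟨Finset.mem_product.2 ⟨ha, ha'⟩, hb⟩, hpa, ?_⟩
        rw [← Real.rpow_natCast, ← Real.rpow_natCast, ← Real.rpow_add hz, ← Real.rpow_add hz]
        exact Real.one_le_rpow_of_pos_of_le_one_of_nonpos hz hz' (by linarith)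
    _ = ∑ i ∈ F ×ˢ F, ∑ b ∈ roughCofactors X w i.1,
          z ^ (-K) * z ^ ArithmeticFunction.cardFactors i.1 *
            z ^ ArithmeticFunction.cardFactors i.2 *
          (progressionPrimes X w (i.1 * i.2 * b)).card := Finset.sum_sigma _ _ _
    _ ≤ ∑ i ∈ F ×ˢ F, ∑ b ∈ roughCofactors X w i.1,
          3 * C * X * W * z ^ (-K) * (f i.1 * f i.2) * (b : ℝ)⁻¹ := by
        refine Finset.sum_le_sum fun i hi => Finset.sum_le_sum fun b hb => ?_
        obtain ⟨hi1, hi2⟩ := Finset.mem_product.1 hi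
        obtain ⟨h1, h1'⟩ := (mem_smallSmooth hX0.le).1 hi1
        obtain ⟨h2, h2'⟩ := (mem_smallSmooth hX0.le).1 hi2
        rw [roughCofactors, Finset.mem_filter] at hb
        have hb0 : 0 < b := by
          rcases Nat.eq_zero_or_pos b with rfl | hb0
          · have h3 := hb.2.2.1
            have : 0 < √X / Real.log X := div_pos (Real.sqrt_pos.2 hX0) (by linarith)
            simp at h3
            linarith
          · exact hb0
        have hq : ((i.1 * i.2 * b : ℕ) : ℝ) ≤ 2 * (X ^ (1 / 10 : ℝ)) ^ 7 := by
          have h4 := hX.log_le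
          have h5 := hX.pow_five
          have h6 := hb.2.2.2
          have h7 := hX.four_le
          set x := X ^ (1 / 10 : ℝ)
          push_cast
          calc (i.1 : ℝ) * i.2 * b = (i.1 * b) * i.2 := by ring
            _ ≤ (2 * √X * Real.log X) * x := by gcongr
            _ ≤ (2 * x ^ 5 * x) * x := by rw [h5]; gcongr
            _ = _ := by ring
        have hq0 : 0 < i.1 * i.2 * b := by
          have := Nat.ne_zero_of_mem_smoothNumbers h1'
          have := Nat.ne_zero_of_mem_smoothNumbers h2'
          positivity
        calc _ ≤ z ^ (-K) * z ^ ArithmeticFunction.cardFactors i.1 *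
              z ^ ArithmeticFunction.cardFactors i.2 *
              (C * (3 * X / (i.1 * i.2 * b : ℕ)) * W) := by
              gcongr
              exact card_progressionPrimes_le h hX hC hq0 hq
          _ = _ := by
              rw [hf]
              push_cast
              field_simp
    _ = ∑ i ∈ F ×ˢ F, 3 * C * X * W * z ^ (-K) * (f i.1 * f i.2) *
          ∑ b ∈ roughCofactors X w i.1, (b : ℝ)⁻¹ := by
        refine Finset.sum_congr rfl fun i _ => ?_
        rw [Finset.mul_sum]
    _ ≤ ∑ i ∈ F ×ˢ F, 3 * C * X * W * z ^ (-K) * (f i.1 * f i.2) * V := by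
        refine Finset.sum_le_sum fun i hi => ?_
        have := hf0 i.1
        have := hf0 i.2
        gcongr
        exact sum_roughCofactors_le h hX hC (Finset.mem_product.1 hi).1
    _ = 3 * C * X * W * z ^ (-K) * V * (∑ a ∈ F, f a) ^ 2 := by
        rw [sq, Finset.sum_mul_sum, ← Finset.sum_product', Finset.mul_sum]
        exact Finset.sum_congr rfl fun i _ => by ring
    _ ≤ 3 * C * X * W * z ^ (-K) * V *
          (Real.exp (9 * invSqSum) * (C * Real.log X) ^ z) ^ 2 := by
        have h1 := sum_smallSmooth_le h hX hz.le (by linarith : z ≤ 3 / 2)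
        have h2 : 0 ≤ ∑ a ∈ F, f a := Finset.sum_nonneg fun a _ => hf0 a
        gcongr
    _ = _ := by
        rw [hV, hW]
        field_simp
        ring

lemma exists_smooth_or_progression {X : ℝ} (hX : IsLarge X) {w p d : ℕ}
    (hp : p ∈ largePrimes X w) (hd : d ∣ p - 1) (hd1 : √X / Real.log X ≤ d)
    (hd2 : (d : ℝ) ≤ 2 * √X * Real.log X) (K : ℝ) :
    (∃ a b : ℕ, p - 1 = a * b ∧ a ∈ w.smoothNumbers ∧ X ^ (1 / 10 : ℝ) < a) ∨
    (∃ a ∈ smallSmooth X w, p ∈ progressionPrimes X w a ∧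
      K ≤ ArithmeticFunction.cardFactors a) ∨
    ∃ a ∈ smallSmooth X w, ∃ a' ∈ smallSmooth X w, ∃ b ∈ roughCofactors X w a,
      p ∈ progressionPrimes X w (a * a' * b) ∧
      (ArithmeticFunction.cardFactors a + ArithmeticFunction.cardFactors a' : ℝ) ≤ K := by
  classical
  have hX0 := hX.pos
  have hp' := hp
  rw [mem_largePrimes hX0.le] at hp'
  have hp2 := hp'.2.1.two_le
  obtain ⟨m, hm⟩ := hd
  have hd0 : d ≠ 0 := by rintro rfl; simp at hm; omega
  have hm0 : m ≠ 0 := by rintro rfl; simp at hm; omega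
  obtain ⟨a, b, rfl, ha, hb⟩ := exists_smooth_mul_rough w hd0
  obtain ⟨a', b', rfl, ha', hb'⟩ := exists_smooth_mul_rough w hm0
  have ha0 := Nat.ne_zero_of_mem_smoothNumbers ha
  have ha0' := Nat.ne_zero_of_mem_smoothNumbers ha'
  have haa := Nat.mul_mem_smoothNumbers ha ha'
  have ha1 : (1 : ℝ) ≤ a := by exact_mod_cast Nat.pos_of_ne_zero ha0
  have ha1' : (1 : ℝ) ≤ a' := by exact_mod_cast Nat.pos_of_ne_zero ha0'
  have hbb : ∀ r ∈ w.primesBelow, ¬ r ∣ b * b' := fun r hr hdvd =>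
    ((Nat.prime_of_mem_primesBelow hr).dvd_mul.1 hdvd).elim (hb r hr) (hb' r hr)
  rcases lt_or_ge (X ^ (1 / 10 : ℝ)) ((a * a' : ℕ) : ℝ) with h1 | h1
  · exact Or.inl ⟨a * a', b * b', by rw [hm]; ring, haa, h1⟩
  have h1' := h1
  push_cast at h1'
  rcases le_or_gt K (ArithmeticFunction.cardFactors (a * a')) with h2 | h2
  · refine Or.inr (Or.inl ⟨a * a', (mem_smallSmooth hX0.le).2 ⟨h1, haa⟩,
      Finset.mem_filter.2 ⟨hp, b * b', ?_, hbb⟩, h2⟩)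
    have : a * a' * (b * b') = a * b * (a' * b') := by ring
    omega
  · refine Or.inr (Or.inr ⟨a, (mem_smallSmooth hX0.le).2 ⟨by nlinarith, ha⟩,
      a', (mem_smallSmooth hX0.le).2 ⟨by nlinarith, ha'⟩, b, ?_,
      Finset.mem_filter.2 ⟨hp, b', ?_, hb'⟩, ?_⟩)
    · push_cast at hd1 hd2
      refine Finset.mem_filter.2 ⟨?_, hb, hd1, hd2⟩
      have hb0 : (0 : ℝ) ≤ b := Nat.cast_nonneg b
      rw [Finset.mem_range, Nat.lt_succ_iff]
      exact Nat.le_floor (by nlinarith)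
    · have : a * a' * b * b' = a * b * (a' * b') := by ring
      omega
    · rw [ArithmeticFunction.cardFactors_mul ha0 ha0'] at h2
      exact_mod_cast h2.le

lemma rpow_inv_log_two_identity {L : ℝ} (hL : 0 < L) :
    (Real.log 2)⁻¹ ^ (-((Real.log 2)⁻¹ * Real.log L)) * L ^ (Real.log 2)⁻¹ / L ^ 2 =
      (L ^ (1 + (1 - (1 + Real.log (Real.log 2)) / Real.log 2)))⁻¹ := by
  have h2 : 0 < Real.log 2 := Real.log_pos one_lt_two
  rw [← Real.rpow_neg hL.le, ← Real.rpow_two, Real.rpow_def_of_pos (inv_pos.2 h2),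
    Real.rpow_def_of_pos hL, Real.rpow_def_of_pos hL, Real.rpow_def_of_pos hL, ← Real.exp_add,
    ← Real.exp_sub, Real.log_inv]
  congr 1
  field_simp
  ring

lemma rpow_inv_two_mul_log_two_identity {L : ℝ} (hL : 0 < L) :
    (2 * Real.log 2)⁻¹ ^ (-((Real.log 2)⁻¹ * Real.log L)) *
        (L ^ (2 * Real.log 2)⁻¹) ^ 2 / L ^ 3 =
      (L ^ (1 + (1 - (1 + Real.log (Real.log 2)) / Real.log 2)))⁻¹ := by
  have h2 : 0 < Real.log 2 := Real.log_pos one_lt_two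
  rw [← Real.rpow_neg hL.le, ← Real.rpow_natCast (L ^ (2 * Real.log 2)⁻¹),
    ← Real.rpow_natCast L, ← Real.rpow_mul hL.le, Real.rpow_def_of_pos (by positivity),
    Real.rpow_def_of_pos hL, Real.rpow_def_of_pos hL, Real.rpow_def_of_pos hL, ← Real.exp_add,
    ← Real.exp_sub, Real.log_inv, Real.log_mul (by norm_num) h2.ne']
  congr 1
  field_simp
  push_cast
  ring

lemma inv_sq_le_rpow_inv {L : ℝ} (hL : 1 ≤ L) :
    1 / L ^ 2 ≤ (L ^ (1 + (1 - (1 + Real.log (Real.log 2)) / Real.log 2)))⁻¹ := by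
  have h2 := Real.log_two_gt_d9
  have h3 : -1 ≤ Real.log (Real.log 2) := by
    rw [Real.le_log_iff_exp_le (by linarith), Real.exp_neg]
    refine inv_le_of_inv_le₀ (by linarith) ?_
    have h4 := Real.exp_one_gt_d9
    refine le_trans ?_ h4.le
    rw [inv_le_comm₀ (by linarith) (by norm_num)]
    exact le_trans (by norm_num) h2.le
  have h4 : 0 ≤ (1 + Real.log (Real.log 2)) / Real.log 2 := div_nonneg (by linarith) (by linarith)
  rw [one_div, ← Real.rpow_two]
  have : 0 < L := by linarith
  gcongr
  linarith

lemma card_le_of_isSiftingLevel {C X : ℝ} {w : ℕ} (h : IsSiftingLevel C X w) (hX : IsLarge X)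
    (hC : 1 ≤ C) :
    ({p : ℕ | p.Prime ∧ (p : ℝ) ≤ 2 * X ∧
        ∃ d : ℕ, d ∣ p - 1 ∧ √X / Real.log X ≤ (d : ℝ) ∧
          (d : ℝ) ≤ 2 * √X * Real.log X}.ncard : ℝ) ≤
      (1 + 2 * C + 3 * C * Real.exp (9 * invSqSum) * C ^ (Real.log 2)⁻¹ +
        54 * C ^ 2 * Real.exp (9 * invSqSum) ^ 2 * (C ^ (2 * Real.log 2)⁻¹) ^ 2) *
      (X * Real.log (Real.log X) ^ 5 *
        (Real.log X ^ (1 + (1 - (1 + Real.log (Real.log 2)) / Real.log 2)))⁻¹) := by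
  classical
  have hX0 := hX.pos
  have ht := hX.one_le_log_log
  have hL2 := hX.two_le_log
  have hlog1 := Real.log_two_gt_d9
  have hlog2 := Real.log_two_lt_d9
  have hC0 : 0 ≤ C := by linarith
  have hlam1 : 1 ≤ (Real.log 2)⁻¹ := (one_le_inv₀ (by linarith)).2 (by linarith)
  have hlam2 : (Real.log 2)⁻¹ ≤ 3 / 2 := by
    rw [inv_le_comm₀ (by linarith) (by norm_num)]
    linarith
  have hmu : (2 * Real.log 2)⁻¹ ≤ 1 := inv_le_one_of_one_le₀ (by linarith)
  have hmu0 : 0 < (2 * Real.log 2)⁻¹ := by positivity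
  have hsq := inv_sq_le_rpow_inv (L := Real.log X) (by linarith)
  have hid1 := rpow_inv_log_two_identity (L := Real.log X) (by linarith)
  have hid2 := rpow_inv_two_mul_log_two_identity (L := Real.log X) (by linarith)
  have hlevel := h.level_le
  have hlogsq := hX.log_sq_le
  have hx10 := hX.pow_ten
  have hx4 := hX.four_le
  set x := X ^ (1 / 10 : ℝ) with hx
  set L := Real.log X with hLd
  set t := Real.log L with htd
  have hL0 : 0 < L := by linarith
  set K := (Real.log 2)⁻¹ * t with hK
  set R := (L ^ (1 + (1 - (1 + Real.log (Real.log 2)) / Real.log 2)))⁻¹ with hR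
  have hR0 : 0 < R := by positivity
  set E₀ := (largePrimes X w).filter fun p =>
    ∃ a b : ℕ, p - 1 = a * b ∧ a ∈ w.smoothNumbers ∧ X ^ (1 / 10 : ℝ) < a with hE₀
  set E₁ := (largePrimes X w).filter fun p => ∃ a ∈ smallSmooth X w,
    p ∈ progressionPrimes X w a ∧ K ≤ ArithmeticFunction.cardFactors a with hE₁
  set E₂ := (largePrimes X w).filter fun p => ∃ a ∈ smallSmooth X w, ∃ a' ∈ smallSmooth X w,
    ∃ b ∈ roughCofactors X w a, p ∈ progressionPrimes X w (a * a' * b) ∧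
      (ArithmeticFunction.cardFactors a + ArithmeticFunction.cardFactors a' : ℝ) ≤ K with hE₂
  have hsub : {p : ℕ | p.Prime ∧ (p : ℝ) ≤ 2 * X ∧
      ∃ d : ℕ, d ∣ p - 1 ∧ √X / L ≤ (d : ℝ) ∧ (d : ℝ) ≤ 2 * √X * L} ⊆
      ((Finset.range w ∪ (E₀ ∪ (E₁ ∪ E₂)) : Finset ℕ) : Set ℕ) := by
    rintro p ⟨hp, hpX, d, hd, hd1, hd2⟩
    rw [Finset.mem_coe]
    rcases lt_or_ge p w with hpw | hpw
    · exact Finset.mem_union_left _ (Finset.mem_range.2 hpw)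
    have hpl : p ∈ largePrimes X w := (mem_largePrimes hX0.le).2 ⟨hpX, hp, hpw⟩
    simp only [Finset.mem_union, hE₀, hE₁, hE₂, Finset.mem_filter]
    rcases exists_smooth_or_progression hX hpl hd hd1 hd2 K with h1 | h1 | h1
    · exact Or.inr (Or.inl ⟨hpl, h1⟩)
    · exact Or.inr (Or.inr (Or.inl ⟨hpl, h1⟩))
    · exact Or.inr (Or.inr (Or.inr ⟨hpl, h1⟩))
  have hcard : ({p : ℕ | p.Prime ∧ (p : ℝ) ≤ 2 * X ∧
      ∃ d : ℕ, d ∣ p - 1 ∧ √X / L ≤ (d : ℝ) ∧ (d : ℝ) ≤ 2 * √X * L}.ncard : ℝ) ≤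
      w + (E₀.card + (E₁.card + E₂.card)) := by
    have h1 := Set.ncard_le_ncard hsub (Finset.finite_toSet _)
    rw [Set.ncard_coe_finset] at h1
    have h2 := Finset.card_union_le (Finset.range w) (E₀ ∪ (E₁ ∪ E₂))
    have h3 := Finset.card_union_le E₀ (E₁ ∪ E₂)
    have h4 := Finset.card_union_le E₁ E₂
    rw [Finset.card_range] at h2
    exact_mod_cast (by omega : _ ≤ w + (E₀.card + (E₁.card + E₂.card)))
  have b0 : (E₀.card : ℝ) ≤ 2 * C * (X / L ^ 2) :=
    card_large_smooth_part_le h hX fun p hp => by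
      obtain ⟨hp1, hp2⟩ := Finset.mem_filter.1 hp
      obtain ⟨hp3, hp4, -⟩ := (mem_largePrimes hX0.le).1 hp1
      exact ⟨hp4.two_le, hp3, hp2⟩
  have b1 := card_many_prime_factors_le h hX hC0 hlam1 hlam2
    fun p (hp : p ∈ E₁) => (Finset.mem_filter.1 hp).2
  have b2 := card_few_prime_factors_le h hX hC0 hmu0 hmu
    fun p (hp : p ∈ E₂) => (Finset.mem_filter.1 hp).2
  rw [Real.mul_rpow hC0 hL0.le] at b1 b2
  have hw : (w : ℝ) ≤ X * (1 / L ^ 2) := by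
    rw [mul_one_div, le_div_iff₀ (by positivity)]
    calc (w : ℝ) * L ^ 2 ≤ x * x := by gcongr
      _ = x ^ 2 := by ring
      _ ≤ x ^ 10 := pow_le_pow_right₀ (by linarith) (by norm_num)
      _ = X := hx10
  have ht5 : 1 ≤ t ^ 5 := one_le_pow₀ ht
  have ht3 : t ^ 3 ≤ t ^ 5 := pow_le_pow_right₀ ht (by norm_num)
  have hQ : X * (1 / L ^ 2) ≤ X * t ^ 5 * R := by
    rw [mul_assoc]
    gcongr
    exact hsq.trans (le_mul_of_one_le_left hR0.le ht5)
  set M := Real.exp (9 * invSqSum) with hM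
  have c0 : 2 * C * (X / L ^ 2) ≤ 2 * C * (X * t ^ 5 * R) := by
    gcongr
    rwa [mul_one_div] at hQ
  have c1 : (E₁.card : ℝ) ≤ 3 * C * M * C ^ (Real.log 2)⁻¹ * (X * t ^ 5 * R) := by
    calc (E₁.card : ℝ) ≤ _ := b1
      _ = 3 * C * M * C ^ (Real.log 2)⁻¹ * (X * t ^ 3 *
          ((Real.log 2)⁻¹ ^ (-K) * L ^ (Real.log 2)⁻¹ / L ^ 2)) := by ring
      _ ≤ _ := by
          rw [hid1]
          gcongr
  have c2 : (E₂.card : ℝ) ≤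
      54 * C ^ 2 * M ^ 2 * (C ^ (2 * Real.log 2)⁻¹) ^ 2 * (X * t ^ 5 * R) := by
    calc (E₂.card : ℝ) ≤ _ := b2
      _ = 54 * C ^ 2 * M ^ 2 * (C ^ (2 * Real.log 2)⁻¹) ^ 2 * (X * t ^ 5 *
          ((2 * Real.log 2)⁻¹ ^ (-K) * (L ^ (2 * Real.log 2)⁻¹) ^ 2 / L ^ 3)) := by ring
      _ = _ := by rw [hid2]
  calc _ ≤ _ := hcard
    _ ≤ X * t ^ 5 * R + (2 * C * (X * t ^ 5 * R) +
          (3 * C * M * C ^ (Real.log 2)⁻¹ * (X * t ^ 5 * R) +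
            54 * C ^ 2 * M ^ 2 * (C ^ (2 * Real.log 2)⁻¹) ^ 2 * (X * t ^ 5 * R))) :=
        add_le_add (hw.trans hQ) (add_le_add (b0.trans c0) (add_le_add c1 c2))
    _ = _ := by ring

/-- With `δ = 1 − (1 + log log 2)/log 2` the Erdős–Ford–Tenenbaum constant, the number of
primes `p ≤ 2X` such that `p − 1` has a divisor in `[√X/log X, 2√X·log X]` is at most
`C·X·(log log X)^C/(log X)^{1+δ}` for some constant `C > 0` and all large `X`. -/
theorem few_primes_with_divisor_in_interval :
    ∃ C : ℝ, 0 < C ∧ ∃ X₀ : ℝ, ∀ X : ℝ, X₀ ≤ X →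
      ({p : ℕ | p.Prime ∧ (p : ℝ) ≤ 2 * X ∧
          ∃ d : ℕ, d ∣ p - 1 ∧ Real.sqrt X / Real.log X ≤ (d : ℝ) ∧
            (d : ℝ) ≤ 2 * Real.sqrt X * Real.log X}.ncard : ℝ) ≤
        C * X * (Real.log (Real.log X)) ^ C /
          (Real.log X) ^ (1 + (1 - (1 + Real.log (Real.log 2)) / Real.log 2)) := by
  obtain ⟨C, hC, X₁, hX₁⟩ := exists_isSiftingLevel
  obtain ⟨X₂, hX₂⟩ := Filter.eventually_atTop.1 eventually_isLarge
  set D := 1 + 2 * C + 3 * C * Real.exp (9 * invSqSum) * C ^ (Real.log 2)⁻¹ +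
    54 * C ^ 2 * Real.exp (9 * invSqSum) ^ 2 * (C ^ (2 * Real.log 2)⁻¹) ^ 2 with hD
  have hD0 : 0 < D := by positivity
  refine ⟨D + 5, by linarith, max X₁ X₂, fun X hX => ?_⟩
  obtain ⟨w, hw⟩ := hX₁ X ((le_max_left _ _).trans hX)
  have hlarge := hX₂ X ((le_max_right _ _).trans hX)
  refine (card_le_of_isSiftingLevel hw hlarge hC).trans ?_
  rw [← hD, div_eq_mul_inv]
  have hX0 := hlarge.pos
  have ht := hlarge.one_le_log_log
  have hL : 0 < Real.log X := by linarith [hlarge.two_le_log]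
  have h5 : Real.log (Real.log X) ^ 5 ≤ Real.log (Real.log X) ^ (D + 5) := by
    rw [← Real.rpow_natCast]
    exact Real.rpow_le_rpow_of_exponent_le ht (by push_cast; linarith)
  rw [← mul_assoc, ← mul_assoc]
  refine mul_le_mul_of_nonneg_right ?_ (by positivity)
  gcongr
  linarith
end

section
/- Let p be an odd prime. Then the image of the rational number ∑_{k=1}^{p−1} (−1)^k/k in ZMod p equals 0 if and only if p² divides 2^{p−1} − 1 (that is, if and only if p is a Wieferich prime). -/
/-- In a division ring, casting commutes with finite sums of rationals whose denominators do not
vanish there. -/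
theorem Rat.cast_sum_of_den_ne_zero {ι α : Type*} [DivisionRing α] (s : Finset ι) (f : ι → ℚ)
    (hf : ∀ i ∈ s, ((f i).den : α) ≠ 0) :
    ((∑ i ∈ s, f i : ℚ) : α) = ∑ i ∈ s, (f i : α) := by
  classical
  suffices h : ((∑ i ∈ s, f i).den : α) ≠ 0 ∧
      ((∑ i ∈ s, f i : ℚ) : α) = ∑ i ∈ s, (f i : α) from h.2
  induction s using Finset.induction_on with
  | empty => simp
  | insert a s ha ih =>
    obtain ⟨hden, hcast⟩ := ih fun i hi => hf i (Finset.mem_insert_of_mem hi)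
    have ha' := hf a (Finset.mem_insert_self a s)
    rw [Finset.sum_insert ha, Finset.sum_insert ha, Rat.cast_add_of_ne_zero ha' hden, hcast]
    refine ⟨fun h => ?_, rfl⟩
    obtain ⟨c, hc⟩ := Rat.add_den_dvd (f a) (∑ i ∈ s, f i)
    have h0 : (((f a).den * (∑ i ∈ s, f i).den : ℕ) : α) = 0 := by
      rw [hc, Nat.cast_mul, h, zero_mul]
    rw [Nat.cast_mul] at h0
    exact mul_ne_zero ha' hden h0

theorem ZMod.natCast_ne_zero_of_pos_of_lt {p k : ℕ} (hk : 0 < k) (hkp : k < p) :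
    (k : ZMod p) ≠ 0 := by
  rw [Ne, ZMod.natCast_eq_zero_iff]
  exact Nat.not_dvd_of_pos_of_lt hk hkp

theorem ZMod.choose_pred_prime (p : ℕ) [Fact p.Prime] {k : ℕ} (hk : k < p) :
    ((p - 1).choose k : ZMod p) = (-1) ^ k := by
  have hp := (Fact.out : p.Prime)
  induction k with
  | zero => simp
  | succ k ih =>
    have h := Nat.choose_succ_succ (p - 1) k
    rw [Nat.succ_eq_add_one, Nat.succ_eq_add_one, Nat.sub_add_cancel hp.one_le] at h
    have h0 : (p.choose (k + 1) : ZMod p) = 0 :=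
      (ZMod.natCast_eq_zero_iff _ _).2 (hp.dvd_choose_self k.succ_ne_zero hk)
    rw [h, Nat.cast_add, ih (by omega)] at h0
    rw [pow_succ]
    linear_combination h0

theorem ZMod.choose_prime_div_self (p : ℕ) [Fact p.Prime] {k : ℕ} (hk : 0 < k) (hkp : k < p) :
    ((p.choose k / p : ℕ) : ZMod p) = -((-1) ^ k / k) := by
  have hp := (Fact.out : p.Prime)
  obtain ⟨j, rfl⟩ := Nat.exists_eq_succ_of_ne_zero hk.ne'
  obtain ⟨c, hc⟩ := hp.dvd_choose_self j.succ_ne_zero hkp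
  have h := Nat.add_one_mul_choose_eq (p - 1) j
  rw [Nat.sub_add_cancel hp.one_le, hc, mul_assoc] at h
  have h' := congrArg (Nat.cast : ℕ → ZMod p) (Nat.eq_of_mul_eq_mul_left hp.pos h)
  rw [Nat.cast_mul, ZMod.choose_pred_prime p (by omega)] at h'
  rw [hc, Nat.mul_div_cancel_left c hp.pos, ← neg_div,
    eq_div_iff (ZMod.natCast_ne_zero_of_pos_of_lt hk hkp), ← h', pow_succ]
  ring

theorem Nat.Prime.two_pow_eq_mul_sum_choose_div_add_two {p : ℕ} (hp : p.Prime) :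
    2 ^ p = p * ∑ k ∈ Finset.Icc 1 (p - 1), p.choose k / p + 2 := by
  have h1 : Finset.range p = insert 0 (Finset.Icc 1 (p - 1)) := by
    ext k
    have := hp.pos
    simp only [Finset.mem_range, Finset.mem_insert, Finset.mem_Icc]
    omega
  rw [← Nat.sum_range_choose, Finset.sum_range_succ, h1, Finset.sum_insert (by simp),
    Finset.mul_sum, Finset.sum_congr rfl fun k hk => ?_, Nat.choose_zero_right, Nat.choose_self]
  · ring
  · rw [Finset.mem_Icc] at hk
    exact (Nat.mul_div_cancel' (hp.dvd_choose_self (by omega) (by omega))).symm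

theorem Rat.cast_zmod_neg_one_pow_div (p : ℕ) [Fact p.Prime] {k : ℕ} (hk : (k : ZMod p) ≠ 0) :
    (((-1 : ℚ) ^ k / k).den : ZMod p) ≠ 0 ∧
      (((-1 : ℚ) ^ k / k : ℚ) : ZMod p) = (-1) ^ k / k := by
  have hq : (-1 : ℚ) ^ k / k = Rat.divInt ((-1) ^ k) k := by
    rw [Rat.divInt_eq_div]
    push_cast
    rfl
  constructor
  · have hd : (((-1 : ℚ) ^ k / k).den : ℤ) ∣ k := hq ▸ Rat.den_dvd _ _
    obtain ⟨c, hc⟩ := Int.natCast_dvd_natCast.1 hd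
    intro h
    apply hk
    rw [hc, Nat.cast_mul, h, zero_mul]
  · rw [hq, Rat.cast_divInt_of_ne_zero _ (by simpa using hk)]
    push_cast
    rfl

/-- For an odd prime `p`, the image of `∑_{k=1}^{p−1} (−1)^k/k` in `ZMod p` vanishes if and
only if `p` is a Wieferich prime, i.e. `p² ∣ 2^{p−1} − 1`. -/
theorem alternating_harmonic_zero_iff_wieferich (p : ℕ) [Fact p.Prime] (hp : p ≠ 2) :
    ((∑ k ∈ Finset.Icc 1 (p - 1), (-1 : ℚ) ^ k / (k : ℚ) : ℚ) : ZMod p) = 0 ↔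
      ((p : ℤ) ^ 2 ∣ 2 ^ (p - 1) - 1) := by
  have hprime := (Fact.out : p.Prime)
  have hne : ∀ k ∈ Finset.Icc 1 (p - 1), (k : ZMod p) ≠ 0 := fun k hk => by
    rw [Finset.mem_Icc] at hk
    exact ZMod.natCast_ne_zero_of_pos_of_lt (by omega) (by omega)
  have hsum : ((∑ k ∈ Finset.Icc 1 (p - 1), (-1 : ℚ) ^ k / (k : ℚ) : ℚ) : ZMod p) =
      -((∑ k ∈ Finset.Icc 1 (p - 1), p.choose k / p : ℕ) : ZMod p) := by
    rw [Rat.cast_sum_of_den_ne_zero _ _ fun k hk => (Rat.cast_zmod_neg_one_pow_div p (hne k hk)).1,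
      Nat.cast_sum, ← Finset.sum_neg_distrib]
    refine Finset.sum_congr rfl fun k hk => ?_
    rw [(Rat.cast_zmod_neg_one_pow_div p (hne k hk)).2]
    rw [Finset.mem_Icc] at hk
    rw [ZMod.choose_prime_div_self p (by omega) (by omega), neg_neg]
  have hpow : (2 : ℤ) * (2 ^ (p - 1) - 1) =
      p * (∑ k ∈ Finset.Icc 1 (p - 1), p.choose k / p : ℕ) := by
    have h : (2 : ℤ) ^ p = p * (∑ k ∈ Finset.Icc 1 (p - 1), p.choose k / p : ℕ) + 2 :=
      mod_cast hprime.two_pow_eq_mul_sum_choose_div_add_two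
    rw [mul_sub, mul_pow_sub_one hprime.ne_zero, h]
    ring
  have hcop : IsCoprime ((p : ℤ) ^ 2) 2 :=
    (Nat.isCoprime_iff_coprime.2 ((Nat.coprime_primes hprime Nat.prime_two).2 hp)).pow_left
  rw [hsum, neg_eq_zero, ZMod.natCast_eq_zero_iff,
    show (p : ℤ) ^ 2 ∣ 2 ^ (p - 1) - 1 ↔ (p : ℤ) ^ 2 ∣ 2 * (2 ^ (p - 1) - 1) from
      ⟨fun h => h.mul_left 2, hcop.dvd_of_dvd_mul_left⟩,
    hpow, sq, mul_dvd_mul_iff_left (Int.natCast_ne_zero.2 hprime.ne_zero), Int.natCast_dvd_natCast]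
end

section
/- Wolstenholme's theorem: for every prime p > 3, the rational number ∑_{k=1}^{p−1} 1/k can be written as p²·z for a rational z whose denominator is not divisible by p; that is, ∑_{k=1}^{p−1} 1/k ≡ 0 (mod p²). -/
theorem ZMod.sum_range_natCast {M : Type*} [AddCommMonoid M] (n : ℕ) [NeZero n]
    (f : ZMod n → M) : ∑ k ∈ Finset.range n, f k = ∑ x : ZMod n, f x := by
  refine Finset.sum_nbij' (fun k => (k : ZMod n)) ZMod.val ?_ ?_ ?_ ?_ ?_
  · simp
  · intro x _
    simpa using ZMod.val_lt x
  · intro k hk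
    exact ZMod.val_cast_of_lt (Finset.mem_range.mp hk)
  · simp
  · simp

theorem ZMod.sum_Icc_inv_sq_eq_zero {p : ℕ} [Fact p.Prime] (h3 : 3 < p) :
    ∑ k ∈ Finset.Icc 1 (p - 1), ((k : ZMod p)⁻¹) ^ 2 = 0 := by
  have hrange : Finset.range p = insert 0 (Finset.Icc 1 (p - 1)) := by
    ext k
    simp only [Finset.mem_range, Finset.mem_insert, Finset.mem_Icc]
    omega
  have hsum := ZMod.sum_range_natCast p (fun x => x⁻¹ ^ 2)
  rw [hrange, Finset.sum_insert (by simp)] at hsum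
  have hsq : ∑ x : ZMod p, x⁻¹ ^ 2 = 0 := by
    refine (Equiv.sum_comp (Equiv.inv (ZMod p)) (fun x => x ^ 2)).trans ?_
    exact FiniteField.sum_pow_lt_card_sub_one _ _ (by rw [ZMod.card]; omega)
  simpa [hsq, -inv_pow] using hsum

theorem Nat.Prime.dvd_sum_factorial_div_mul_factorial_div {p : ℕ} (hp : p.Prime) (h3 : 3 < p) :
    p ∣ ∑ k ∈ Finset.Icc 1 (p - 1),
      ((p - 1).factorial / k) * ((p - 1).factorial / (p - k)) := by
  have : Fact p.Prime := ⟨hp⟩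
  have hcast (k : ℕ) (hk : 1 ≤ k) (hkp : k ≤ p - 1) :
      (((p - 1).factorial / k : ℕ) : ZMod p) = (p - 1).factorial * (k : ZMod p)⁻¹ := by
    have hk0 : (k : ZMod p) ≠ 0 := by
      rw [Ne, ZMod.natCast_eq_zero_iff]
      exact Nat.not_dvd_of_pos_of_lt hk (by omega)
    rw [Nat.cast_div (Nat.dvd_factorial hk hkp) hk0, div_eq_mul_inv]
  rw [← ZMod.natCast_eq_zero_iff, Nat.cast_sum]
  calc
    _ = ∑ k ∈ Finset.Icc 1 (p - 1),
        -((p - 1).factorial : ZMod p) ^ 2 * ((k : ZMod p)⁻¹) ^ 2 := by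
      refine Finset.sum_congr rfl fun k hk => ?_
      rw [Finset.mem_Icc] at hk
      rw [Nat.cast_mul, hcast k hk.1 hk.2, hcast (p - k) (by omega) (by omega),
        Nat.cast_sub (by omega), ZMod.natCast_self, zero_sub, inv_neg]
      ring
    _ = 0 := by rw [← Finset.mul_sum, ZMod.sum_Icc_inv_sq_eq_zero h3, mul_zero]

theorem two_mul_factorial_sq_mul_sum_one_div (p : ℕ) :
    2 * ((p - 1).factorial : ℚ) ^ 2 * ∑ k ∈ Finset.Icc 1 (p - 1), (1 : ℚ) / (k : ℚ) =
      p * ((∑ k ∈ Finset.Icc 1 (p - 1),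
        ((p - 1).factorial / k) * ((p - 1).factorial / (p - k)) : ℕ) : ℚ) := by
  have hrefl : ∑ k ∈ Finset.Icc 1 (p - 1), (1 : ℚ) / (k : ℚ) =
      ∑ k ∈ Finset.Icc 1 (p - 1), (1 : ℚ) / ((p - k : ℕ) : ℚ) := by
    refine Finset.sum_nbij' (fun k => p - k) (fun k => p - k) ?_ ?_ ?_ ?_ ?_ <;>
      intro k hk <;> rw [Finset.mem_Icc] at hk
    · rw [Finset.mem_Icc]; omega
    · rw [Finset.mem_Icc]; omega
    · omega
    · omega
    · rw [Nat.sub_sub_self (by omega)]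
  rw [mul_comm 2, mul_assoc, two_mul]
  nth_rewrite 2 [hrefl]
  rw [← Finset.sum_add_distrib, Nat.cast_sum, Finset.mul_sum, Finset.mul_sum]
  refine Finset.sum_congr rfl fun k hk => ?_
  rw [Finset.mem_Icc] at hk
  have hk0 : (k : ℚ) ≠ 0 := by norm_cast; omega
  have hpk0 : ((p - k : ℕ) : ℚ) ≠ 0 := by norm_cast; omega
  rw [Nat.cast_mul, Nat.cast_div (Nat.dvd_factorial (by omega) hk.2) hk0,
    Nat.cast_div (Nat.dvd_factorial (by omega) (by omega)) hpk0]
  have hp : (p : ℚ) = k + (p - k : ℕ) := by norm_cast; omega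
  rw [hp]
  field_simp
  ring

/-- Wolstenholme's theorem: for every prime `p > 3`, the harmonic sum `∑_{k=1}^{p−1} 1/k`
equals `p²·z` for some rational `z` whose denominator is not divisible by `p`. -/
theorem wolstenholme (p : ℕ) (hp : p.Prime) (h3 : 3 < p) :
    ∃ z : ℚ, ¬ (p ∣ z.den) ∧
      (∑ k ∈ Finset.Icc 1 (p - 1), (1 : ℚ) / (k : ℚ)) = (p : ℚ) ^ 2 * z := by
  obtain ⟨t, ht⟩ := hp.dvd_sum_factorial_div_mul_factorial_div h3
  have hsum := two_mul_factorial_sq_mul_sum_one_div p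
  rw [ht, Nat.cast_mul] at hsum
  refine ⟨((t : ℤ) : ℚ) / ((2 * (p - 1).factorial ^ 2 : ℕ) : ℤ), fun hdvd => ?_, ?_⟩
  · rw [← Rat.divInt_eq_div] at hdvd
    have hden := hdvd.trans (Int.natCast_dvd_natCast.mp (Rat.den_dvd _ _))
    rcases hp.dvd_mul.mp hden with h | h
    · exact absurd (Nat.le_of_dvd two_pos h) (by omega)
    · have := hp.dvd_factorial.mp (hp.dvd_of_dvd_pow h)
      omega
  · have hF : ((p - 1).factorial : ℚ) ≠ 0 := by exact_mod_cast Nat.factorial_ne_zero _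
    push_cast
    rw [← mul_div_assoc, eq_div_iff (by positivity), mul_comm, hsum]
    ring
end

section
/- Glaisher's congruence modulo p³: let m > 1 be an odd integer and p > m a prime. Then −((m−1)(m−2)/(2m))·p²·B_{p−m} ≡ ∑_{k=1}^{p−1} 1/k^{m−2} (mod p³), where B_n denotes the n-th Bernoulli number. -/
open Finset

section CommRing

variable {R : Type*} [CommRing R]

theorem sq_dvd_one_add_pow_sub (y : R) (n : ℕ) : y ^ 2 ∣ (1 + y) ^ n - (1 + n * y) := by
  induction n with
  | zero => simp
  | succ n ih =>
    obtain ⟨c, hc⟩ := ih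
    refine ⟨c * (1 + y) + n, ?_⟩
    push_cast
    linear_combination (1 + y) * hc

theorem cube_dvd_two_mul_one_add_add_sq_pow_sub (y : R) (r : ℕ) :
    y ^ 3 ∣ 2 * (1 + y + y ^ 2) ^ r - (2 + 2 * r * y + r * (r + 1) * y ^ 2) := by
  induction r with
  | zero => simp
  | succ r ih =>
    obtain ⟨c, hc⟩ := ih
    refine ⟨c * (1 + y + y ^ 2) + 2 * r + r * (r + 1) + r * (r + 1) * y, ?_⟩
    push_cast
    linear_combination (1 + y + y ^ 2) * hc

theorem inv_sub_eq_neg_inv_mul {P x i i' : R} (hx : x * i = 1) (hy : (P - x) * i' = 1) :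
    i' - -(i * (1 + P * i + (P * i) ^ 2)) = P ^ 3 * (i ^ 3 * i') := by
  linear_combination i' * ((1 - P ^ 3 * i ^ 3) * hy - (1 + P * i + P ^ 2 * i ^ 2) * hx)
    - (i' + i + P * i ^ 2 + P ^ 2 * i ^ 3 - P ^ 3 * i ^ 3 * i') * hy

theorem cube_dvd_inv_sub_pow {P x i i' : R} (hx : x * i = 1) (hy : (P - x) * i' = 1)
    {r : ℕ} (hr : Odd r) :
    P ^ 3 ∣ 2 * i' ^ r + (2 * i ^ r + 2 * r * P * i ^ (r + 1)
      + r * (r + 1) * P ^ 2 * i ^ (r + 2)) := by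
  have h₁ := (Dvd.intro _ (inv_sub_eq_neg_inv_mul hx hy).symm).trans
    (sub_dvd_pow_sub_pow i' (-(i * (1 + P * i + (P * i) ^ 2))) r)
  have h₂ : P ^ 3 ∣ _ := (Dvd.intro _ (mul_pow P i 3).symm).trans
    (cube_dvd_two_mul_one_add_add_sq_pow_sub (P * i) r)
  rw [hr.neg_pow, mul_pow] at h₁
  convert (h₁.mul_left 2).sub (h₂.mul_left (i ^ r)) using 1
  ring

theorem dvd_inv_sub_pow_add {P x i i' : R} (hx : x * i = 1) (hy : (P - x) * i' = 1)
    {m : ℕ} (hm : Odd m) : P ∣ i ^ m + i' ^ m := by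
  refine Dvd.dvd.trans ⟨i * i', ?_⟩ (hm.add_dvd_pow_add_pow i i')
  linear_combination (-i') * hx - i * hy

theorem sq_dvd_mul_inv_pow_add {p n e : ℕ} (hne : n + e + 1 = p) {x j : R} (hx : x * j = 1)
    (hF : (p : R) ∣ x ^ (p - 1) - 1) :
    (p : R) ^ 2 ∣ n * j ^ e + e * x ^ n - (p - 1) * x ^ (p * n) := by
  obtain ⟨q, hq⟩ := hF
  have hp1 : p - 1 = n + e := by omega
  have hpow : x ^ (n + e) = 1 + p * q := by rw [← hp1]; linear_combination hq
  have hxn : x ^ n = j ^ e * (1 + p * q) := by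
    have hje : x ^ e * j ^ e = 1 := by rw [← mul_pow, hx, one_pow]
    rw [← hpow, pow_add]
    linear_combination (-x ^ n) * hje
  have hxpn : x ^ (p * n) = j ^ e * (1 + p * q) ^ (n + 1) := by
    have : p * n = n + (n + e) * n := by rw [← hne]; ring
    rw [this, pow_add, pow_mul, hpow, hxn]
    ring
  obtain ⟨c, hc⟩ := sq_dvd_one_add_pow_sub ((p : R) * q) (n + 1)
  have hpR : (p : R) = n + e + 1 := by rw [← hne]; push_cast; ring
  refine ⟨-j ^ e * (n * q + (p - 1) * q ^ 2 * c), ?_⟩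
  rw [hxn, hxpn]
  push_cast at hc
  linear_combination (-(p - 1 : R) * j ^ e) * hc - j ^ e * (1 + p * q) * hpR

variable {p : ℕ} {j : ℕ → R}

theorem cube_dvd_sum_inv_pow_add (hj : ∀ k ∈ Icc 1 (p - 1), (k : R) * j k = 1)
    {r : ℕ} (hr : Odd r) :
    (p : R) ^ 3 ∣ 8 * ∑ k ∈ Icc 1 (p - 1), j k ^ r
      + 4 * r * p * ∑ k ∈ Icc 1 (p - 1), j k ^ (r + 1) := by
  have hj' : ∀ k ∈ Icc 1 (p - 1), ((p : R) - k) * j (p - k) = 1 := fun k hk ↦ by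
    rw [mem_Icc] at hk
    rw [← Nat.cast_sub (by omega)]
    exact hj _ (mem_Icc.2 (by omega))
  have hrefl (s : ℕ) :
      ∑ k ∈ Icc 1 (p - 1), j (p - k) ^ s = ∑ k ∈ Icc 1 (p - 1), j k ^ s := by
    refine sum_nbij' (p - ·) (p - ·) ?_ ?_ ?_ ?_ fun _ _ ↦ rfl
    all_goals intro k hk; simp only [mem_Icc] at hk ⊢; omega
  have h₁ := dvd_sum fun k hk ↦ cube_dvd_inv_sub_pow (hj k hk) (hj' k hk) hr
  have h₂ := dvd_sum fun k hk ↦ dvd_inv_sub_pow_add (hj k hk) (hj' k hk)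
    (hr.add_even even_two : Odd (r + 2))
  simp only [sum_add_distrib, ← mul_sum, hrefl] at h₁ h₂
  obtain ⟨a, ha⟩ := h₁
  obtain ⟨b, hb⟩ := h₂
  refine ⟨2 * a - r * (r + 1) * b, ?_⟩
  linear_combination 2 * ha - r * (r + 1) * (p : R) ^ 2 * hb

theorem sq_dvd_mul_sum_inv_pow_add {n e : ℕ} (hne : n + e + 1 = p)
    (hj : ∀ k ∈ Icc 1 (p - 1), (k : R) * j k = 1)
    (hF : ∀ k ∈ Icc 1 (p - 1), (p : R) ∣ (k : R) ^ (p - 1) - 1)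
    (hS : (p : R) ^ 2 ∣ ∑ k ∈ Icc 1 (p - 1), (k : R) ^ (p * n)) :
    (p : R) ^ 2 ∣ n * ∑ k ∈ Icc 1 (p - 1), j k ^ e + e * ∑ k ∈ Icc 1 (p - 1), (k : R) ^ n := by
  have h := dvd_sum fun k hk ↦ sq_dvd_mul_inv_pow_add hne (hj k hk) (hF k hk)
  simp only [sum_add_distrib, sum_sub_distrib, ← mul_sum] at h
  convert h.add (hS.mul_left (p - 1 : R)) using 1
  ring

theorem cube_dvd_sum_inv_pow_add_of_sum_pow {m n r : ℕ} {b v : R} (hr : Odd r) (hm : m = r + 2)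
    (hnm : n + m = p) (hv : (n : R) * v = 1)
    (hj : ∀ k ∈ Icc 1 (p - 1), (k : R) * j k = 1)
    (hF : ∀ k ∈ Icc 1 (p - 1), (p : R) ∣ (k : R) ^ (p - 1) - 1)
    (hS : (p : R) ^ 2 ∣ ∑ k ∈ Icc 1 (p - 1), (k : R) ^ (p * n))
    (hb : (p : R) ^ 2 ∣ ∑ k ∈ Icc 1 (p - 1), (k : R) ^ n - p * b) :
    (p : R) ^ 3 ∣ 8 * m * ∑ k ∈ Icc 1 (p - 1), j k ^ r + 4 * r * (r + 1) * p ^ 2 * b := by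
  obtain ⟨c, hc⟩ := cube_dvd_sum_inv_pow_add hj hr
  obtain ⟨d, hd⟩ := sq_dvd_mul_sum_inv_pow_add (e := r + 1) (by omega) hj hF hS
  obtain ⟨f, hf⟩ := hb
  have hpR : (p : R) = n + m := by rw [← hnm]; push_cast; ring
  push_cast at hd
  set T := ∑ k ∈ Icc 1 (p - 1), (k : R) ^ n
  set S := ∑ k ∈ Icc 1 (p - 1), j k ^ (r + 1)
  obtain ⟨g, hg⟩ : (p : R) ∣ S :=
    ⟨v * (p * d - (r + 1) * (b + p * f)), by
      linear_combination v * hd - v * (r + 1) * hf - S * hv⟩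
  refine ⟨m * c + 4 * r * (d - (r + 1) * f - g), ?_⟩
  linear_combination m * hc + 4 * r * p * hd - 4 * r * p * (r + 1) * hf
    - 4 * r * p * p * hg + 4 * r * p * S * hpR

end CommRing

theorem sum_zmod_val_eq_sum_Icc {p : ℕ} [NeZero p] {M : Type*} [AddCommMonoid M] (f : ℕ → M)
    (hf : f 0 = 0) : ∑ x : ZMod p, f x.val = ∑ k ∈ Icc 1 (p - 1), f k := by
  have hp := NeZero.pos p
  have : ∑ x : ZMod p, f x.val = ∑ k ∈ range p, f k :=
    sum_nbij' ZMod.val (fun k ↦ (k : ZMod p)) (by simp [ZMod.val_lt]) (by simp)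
      (by simp) (fun k hk ↦ ZMod.val_cast_of_lt (mem_range.1 hk)) (by simp)
  rw [this]
  refine (sum_subset (fun k hk ↦ ?_) fun k hk hk' ↦ ?_).symm
  · rw [mem_Icc] at hk; exact mem_range.2 (by omega)
  · rw [mem_range] at hk
    rw [mem_Icc] at hk'
    rw [show k = 0 by omega, hf]

theorem sq_dvd_sum_pow_mul {p n : ℕ} [hp : Fact p.Prime] (hn : ¬ (p - 1) ∣ n) :
    (p : ℤ) ^ 2 ∣ ∑ k ∈ Icc 1 (p - 1), (k : ℤ) ^ (p * n) := by
  have hn0 : n ≠ 0 := by rintro rfl; simp at hn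
  have hpn0 : p * n ≠ 0 := mul_ne_zero hp.out.ne_zero hn0
  obtain ⟨g, hg⟩ : ∃ g : (ZMod p)ˣ, g ^ n ≠ 1 := by
    by_contra! h
    exact hn (by simpa using (FiniteField.forall_pow_eq_one_iff (ZMod p) n).1 h)
  rw [← sum_zmod_val_eq_sum_Icc (fun k ↦ (k : ℤ) ^ (p * n)) (by simp [hpn0])]
  set S := ∑ x : ZMod p, (x.val : ℤ) ^ (p * n)
  have hperm : ∑ x : ZMod p, ((g * x : ZMod p).val : ℤ) ^ (p * n) = S :=
    Equiv.sum_comp g.mulLeft fun x : ZMod p ↦ (x.val : ℤ) ^ (p * n)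
  have hdvd : (p : ℤ) ^ 2 ∣ ∑ x : ZMod p, (((g : ZMod p).val * x.val : ℤ) ^ (p * n)
      - ((g * x : ZMod p).val : ℤ) ^ (p * n)) := by
    refine dvd_sum fun x _ ↦ ?_
    rw [pow_mul, pow_mul]
    refine Dvd.dvd.trans ?_ (sub_dvd_pow_sub_pow _ _ n)
    have := dvd_sub_pow_of_dvd_sub (R := ℤ) (p := p)
      (a := (g : ZMod p).val * x.val) (b := (g * x : ZMod p).val)
      ((ZMod.intCast_zmod_eq_zero_iff_dvd _ p).1 (by simp)) 1
    simpa using this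
  rw [sum_sub_distrib, hperm] at hdvd
  simp only [mul_pow, ← mul_sum] at hdvd
  rw [← sub_one_mul] at hdvd
  refine IsCoprime.dvd_of_dvd_mul_left (IsCoprime.pow_left ?_) hdvd
  refine ((Nat.prime_iff_prime_int.1 hp.out).coprime_iff_not_dvd).2 fun h ↦ hg ?_
  have h' := (ZMod.intCast_zmod_eq_zero_iff_dvd _ p).2 h
  ext
  simpa [pow_mul, sub_eq_zero] using h'

/-- The ring of `p`-integral rational numbers. -/
abbrev pIntegralRat (p : ℕ) [Fact p.Prime] : Subring ℚ := (Rat.padicValuation p).integer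

section pIntegralRat

variable {p : ℕ} [hp : Fact p.Prime]

theorem mem_pIntegralRat_iff {x : ℚ} : x ∈ pIntegralRat p ↔ ¬ p ∣ x.den :=
  Rat.padicValuation_le_one_iff

theorem inv_natCast_mem_pIntegralRat {k : ℕ} (hk : ¬ p ∣ k) : (k : ℚ)⁻¹ ∈ pIntegralRat p := by
  rw [mem_pIntegralRat_iff]
  rcases eq_or_ne k 0 with rfl | h
  · simp at hk
  · rwa [Rat.inv_natCast_den_of_pos (Nat.pos_of_ne_zero h)]

theorem bernoulli_mem_pIntegralRat {n : ℕ} (hn : n + 1 < p) : bernoulli n ∈ pIntegralRat p := by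
  induction n using Nat.strong_induction_on with
  | _ n ih =>
    rcases eq_or_ne n 0 with rfl | h0
    · simp
    have h := sum_bernoulli (n + 1)
    rw [sum_range_succ, if_neg (by omega), Nat.choose_succ_self_right] at h
    have hn1 : ((n + 1 : ℕ) : ℚ) ≠ 0 := by positivity
    have : bernoulli n =
        -(((n + 1 : ℕ) : ℚ)⁻¹ * ∑ k ∈ range n, ((n + 1).choose k : ℚ) * bernoulli k) := by
      field_simp
      linear_combination h
    rw [this]
    refine neg_mem (mul_mem (inv_natCast_mem_pIntegralRat
      (Nat.not_dvd_of_pos_of_lt n.succ_pos hn)) (sum_mem fun k hk ↦ ?_))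
    rw [mem_range] at hk
    exact mul_mem (natCast_mem _ _) (ih k hk (by omega))

theorem exists_sum_pow_sub_bernoulli {n : ℕ} (hn0 : n ≠ 0) (hn : n + 1 < p) :
    ∃ z ∈ pIntegralRat p,
      ∑ k ∈ Icc 1 (p - 1), (k : ℚ) ^ n - p * bernoulli n = p ^ 2 * z := by
  have hn1 : (n : ℚ) + 1 ≠ 0 := by positivity
  have hsum : ∑ k ∈ Icc 1 (p - 1), (k : ℚ) ^ n = ∑ k ∈ range p, (k : ℚ) ^ n := by
    rw [range_eq_Ico, sum_eq_sum_Ico_succ_bot hp.out.pos]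
    have : Icc 1 (p - 1) = Ico (0 + 1) p := by
      ext; simp only [mem_Icc, mem_Ico]; have := hp.out.pos; omega
    simp [this, hn0]
  refine ⟨∑ i ∈ range n, bernoulli i * ((n + 1).choose i) * p ^ (n - 1 - i)
    * ((n + 1 : ℕ) : ℚ)⁻¹, sum_mem fun i hi ↦ ?_, ?_⟩
  · rw [mem_range] at hi
    exact mul_mem (mul_mem (mul_mem (bernoulli_mem_pIntegralRat (by omega)) (natCast_mem _ _))
      (pow_mem (natCast_mem _ _) _))
      (inv_natCast_mem_pIntegralRat (Nat.not_dvd_of_pos_of_lt n.succ_pos hn))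
  · rw [hsum, sum_range_pow, sum_range_succ, mul_sum, Nat.choose_succ_self_right]
    have : n + 1 - n = 1 := by omega
    rw [this, add_sub_assoc]
    have h0 : bernoulli n * ((n + 1 : ℕ) : ℚ) * (p : ℚ) ^ 1 / (n + 1) - p * bernoulli n = 0 := by
      push_cast
      field_simp
      ring
    rw [h0, add_zero]
    refine sum_congr rfl fun i hi ↦ ?_
    rw [mem_range] at hi
    have : n + 1 - i = 2 + (n - 1 - i) := by omega
    rw [this, pow_add, div_eq_mul_inv]
    push_cast
    ring

end pIntegralRat

/-- Glaisher's congruence modulo `p³`: for odd `m > 1` and a prime `p > m`,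
`−((m−1)(m−2)/(2m))·p²·B_{p−m} ≡ ∑_{k=1}^{p−1} 1/k^{m−2} (mod p³)`. -/
theorem glaisher_mod_p_cubed (m : ℕ) (hodd : Odd m) (hm : 1 < m)
    (p : ℕ) (hp : p.Prime) (hmp : m < p) :
    ∃ z : ℚ, ¬ (p ∣ z.den) ∧
      (-(((m : ℚ) - 1) * ((m : ℚ) - 2) / (2 * (m : ℚ))) * (p : ℚ) ^ 2 * bernoulli (p - m)) -
        (∑ k ∈ Finset.Icc 1 (p - 1), 1 / (k : ℚ) ^ (m - 2)) = (p : ℚ) ^ 3 * z := by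
  have : Fact p.Prime := ⟨hp⟩
  obtain ⟨r, rfl⟩ : ∃ r, m = r + 2 := ⟨m - 2, by omega⟩
  obtain ⟨n, rfl⟩ : ∃ n, p = n + (r + 2) := ⟨p - (r + 2), by omega⟩
  have hr : Odd r := by
    rw [Nat.odd_add] at hodd; exact hodd.2 even_two
  set p := n + (r + 2) with hpdef
  have hunit {k : ℕ} (h0 : 0 < k) (hk : k < p) : ¬ p ∣ k := Nat.not_dvd_of_pos_of_lt h0 hk
  have hr1 : 0 < r := hr.pos
  let R := pIntegralRat p
  let inv (k : ℕ) : R := if h : p ∣ k then 0 else ⟨(k : ℚ)⁻¹, inv_natCast_mem_pIntegralRat h⟩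
  have hinv {k : ℕ} (h : ¬ p ∣ k) : ((inv k : R) : ℚ) = (k : ℚ)⁻¹ := by simp [inv, h]
  have hmul {k : ℕ} (h : ¬ p ∣ k) : (k : R) * inv k = 1 := by
    have hk : (k : ℚ) ≠ 0 := by rintro h'; simp at h'; simp [h'] at h
    apply Subtype.ext
    push_cast
    rw [hinv h, mul_inv_cancel₀ hk]
  have hIcc {k : ℕ} (hk : k ∈ Icc 1 (p - 1)) : ¬ p ∣ k := by
    rw [mem_Icc] at hk; exact hunit (by omega) (by omega)
  have hn : n + 1 < p := by omega
  obtain ⟨z, hz, hzeq⟩ := exists_sum_pow_sub_bernoulli (p := p) (n := n) (by omega) hn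
  obtain ⟨w, hw⟩ := cube_dvd_sum_inv_pow_add_of_sum_pow (R := R) (p := p) (j := inv)
    (b := ⟨bernoulli n, bernoulli_mem_pIntegralRat hn⟩) hr rfl hpdef.symm
    (hmul (hunit (by omega) (by omega))) (fun k hk ↦ hmul (hIcc hk))
    (fun k hk ↦ by
      have h : (p : ℤ) ∣ (k : ℤ) ^ (p - 1) - 1 :=
        (Int.ModEq.pow_card_sub_one_eq_one hp (Nat.isCoprime_iff_coprime.2
          ((hp.coprime_iff_not_dvd).2 (hIcc hk)).symm)).symm.dvd
      simpa using map_dvd (Int.castRingHom R) h)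
    (by
      have h := sq_dvd_sum_pow_mul (p := p) (n := n)
        (Nat.not_dvd_of_pos_of_lt (by omega) (by omega))
      simpa using map_dvd (Int.castRingHom R) h)
    ⟨⟨z, hz⟩, Subtype.ext (by push_cast; exact hzeq)⟩
  have h8 : ¬ p ∣ 8 * (r + 2) := by
    rw [hp.dvd_mul, not_or]
    refine ⟨fun h ↦ ?_, hunit (by omega) hmp⟩
    have := (Nat.prime_dvd_prime_iff_eq hp Nat.prime_two).1 (hp.dvd_of_dvd_pow (n := 3) h)
    omega
  refine ⟨-(w * inv (8 * (r + 2)) : R), mem_pIntegralRat_iff.1 (neg_mem (w * inv _).2), ?_⟩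
  have hw' := congrArg (Subtype.val : R → ℚ) hw
  push_cast at hw'
  have hsum : ∑ k ∈ Icc 1 (p - 1), ((inv k : R) : ℚ) ^ r =
      ∑ k ∈ Icc 1 (p - 1), 1 / (k : ℚ) ^ r :=
    sum_congr rfl fun k hk ↦ by rw [hinv (hIcc hk), inv_pow, one_div]
  rw [hsum, show ((8 : R) : ℚ) = 8 from rfl, show ((4 : R) : ℚ) = 4 from rfl,
    show ((2 : R) : ℚ) = 2 from rfl] at hw'
  have hpn : p - (r + 2) = n := by omega
  have hr2 : (r : ℚ) + 2 ≠ 0 := by positivity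
  push_cast
  rw [hinv h8, hpn]
  push_cast
  field_simp
  linear_combination (-2) * hw'
end

section
/- Glaisher's congruence modulo p²: let m > 1 be an odd integer and p > m a prime. Then ((m−1)/m)·p·B_{p−m} ≡ ∑_{k=1}^{p−1} 1/k^{m−1} (mod p²), where B_n denotes the n-th Bernoulli number. -/
/-- The subring of rationals whose denominator is not divisible by the prime `p`. -/
def Rat.primeToDen (p : ℕ) (hp : p.Prime) : Subring ℚ where
  carrier := {x | ¬ p ∣ x.den}
  mul_mem' {a b} ha hb h :=
    (hp.dvd_mul.1 (h.trans (Rat.mul_den_dvd a b))).elim ha hb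
  one_mem' := by simpa using hp.one_lt.ne'
  add_mem' {a b} ha hb h :=
    (hp.dvd_mul.1 (h.trans (Rat.add_den_dvd a b))).elim ha hb
  zero_mem' := by simpa using hp.one_lt.ne'
  neg_mem' {a} ha := by simpa using ha

namespace Rat.primeToDen

variable {p : ℕ} {hp : p.Prime}

lemma inv_natCast_mem {k : ℕ} (hk0 : 0 < k) (hkp : k < p) :
    (k : ℚ)⁻¹ ∈ primeToDen p hp := by
  intro h
  rw [Rat.inv_natCast_den, if_neg hk0.ne'] at h
  exact absurd (Nat.le_of_dvd hk0 h) (by lia)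

lemma bernoulli'_mem {n : ℕ} (hn : n + 1 < p) : bernoulli' n ∈ primeToDen p hp := by
  induction n using Nat.strong_induction_on with
  | _ n ih =>
    rw [bernoulli'_def]
    refine sub_mem (one_mem _) (sum_mem fun k hk => ?_)
    have hk := Finset.mem_range.1 hk
    refine mul_mem ?_ (ih k hk (by lia))
    rw [div_eq_mul_inv]
    refine mul_mem (natCast_mem _ _) ?_
    have : ((n : ℚ) - k + 1) = ((n - k + 1 : ℕ) : ℚ) := by
      push_cast [Nat.cast_sub hk.le]; ring
    rw [this]
    exact inv_natCast_mem (by lia) (by lia)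

lemma bernoulli_mem {n : ℕ} (hn : n + 1 < p) : bernoulli n ∈ primeToDen p hp := by
  rw [bernoulli]
  exact mul_mem (pow_mem (neg_mem (one_mem _)) _) (bernoulli'_mem hn)

/-- For `n + 1 < p`, the power sum `∑_{k<p} k^n` is congruent to `p B_n` modulo `p²`. -/
lemma exists_sum_range_pow_eq {n : ℕ} (hn : n + 1 < p) :
    ∃ w ∈ primeToDen p hp,
      ∑ k ∈ Finset.range p, (k : ℚ) ^ n = p * bernoulli n + p ^ 2 * w := by
  refine ⟨∑ i ∈ Finset.range n,
    bernoulli i * (n + 1).choose i * p ^ (n - 1 - i) * ((n + 1 : ℕ) : ℚ)⁻¹,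
    sum_mem fun i hi => ?_, ?_⟩
  · have hi := Finset.mem_range.1 hi
    exact mul_mem (mul_mem (mul_mem (bernoulli_mem (by lia)) (natCast_mem _ _))
      (pow_mem (natCast_mem _ _) _)) (inv_natCast_mem (by lia) (by lia))
  · have h0 : (n : ℚ) + 1 ≠ 0 := by positivity
    rw [sum_range_pow, Finset.sum_range_succ, add_comm, Finset.mul_sum]
    congr 1
    · simp only [Nat.choose_succ_self_right, Nat.add_sub_cancel_left, pow_one]
      push_cast
      field_simp
    · refine Finset.sum_congr rfl fun i hi => ?_
      have hi := Finset.mem_range.1 hi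
      rw [show n + 1 - i = 2 + (n - 1 - i) by lia, pow_add]
      push_cast
      ring

end Rat.primeToDen

section PowerSums

variable {p : ℕ} [Fact p.Prime]

lemma ZMod.sum_val_eq_sum_range {M : Type*} [AddCommMonoid M] (f : ℕ → M) :
    ∑ x : ZMod p, f x.val = ∑ k ∈ Finset.range p, f k :=
  Finset.sum_nbij' (fun x => x.val) (fun k => (k : ZMod p))
    (fun x _ => Finset.mem_range.2 x.val_lt) (fun _ _ => Finset.mem_univ _)
    (fun x _ => ZMod.natCast_zmod_val x)
    (fun _ hk => ZMod.val_cast_of_lt (Finset.mem_range.1 hk)) (fun _ _ => rfl)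

/-- Comparison of `∑ k^n` with `∑ (gk)^n` modulo `p²`, where `gk` is divided by `p` with
remainder. -/
lemma sq_dvd_pow_sub_one_mul_sum_pow_sub (g : (ZMod p)ˣ) (n : ℕ) :
    (p : ℤ) ^ 2 ∣ ((g : ZMod p).val ^ n - 1) * ∑ k ∈ Finset.range p, (k : ℤ) ^ n -
      n * p * ∑ x : ZMod p,
        (((g : ZMod p).val * x.val / p : ℕ) : ℤ) * ((g * x : ZMod p).val : ℤ) ^ (n - 1) := by
  rw [← ZMod.sum_val_eq_sum_range (fun k => (k : ℤ) ^ n), sub_mul, one_mul]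
  have hperm : ∑ x : ZMod p, (x.val : ℤ) ^ n = ∑ x : ZMod p, ((g * x : ZMod p).val : ℤ) ^ n :=
    (Equiv.sum_comp (Units.mulLeft g) fun x : ZMod p => (x.val : ℤ) ^ n).symm
  nth_rewrite 2 [hperm]
  rw [Finset.mul_sum, Finset.mul_sum, ← Finset.sum_sub_distrib, ← Finset.sum_sub_distrib]
  refine Finset.dvd_sum fun x _ => ?_
  obtain ⟨c, hc⟩ := Polynomial.powAddExpansion ((g * x : ZMod p).val : ℤ)
    (p * ((g : ZMod p).val * x.val / p : ℕ)) n
  have hdiv : ((g : ZMod p).val : ℤ) * x.val =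
      (g * x : ZMod p).val + p * ((g : ZMod p).val * x.val / p : ℕ) := by
    rw [ZMod.val_mul]
    exact_mod_cast (Nat.mod_add_div _ _).symm
  rw [← mul_pow, hdiv, hc]
  exact ⟨c * ((g : ZMod p).val * x.val / p : ℕ) ^ 2, by ring⟩

lemma exists_unit_pow_ne_one {n : ℕ} (hn0 : 0 < n) (hn : n < p - 1) :
    ∃ g : (ZMod p)ˣ, ¬ (p : ℤ) ∣ ((g : ZMod p).val : ℤ) ^ n - 1 := by
  obtain ⟨g, hg⟩ := exists_pow_ne_one_of_isCyclic (G := (ZMod p)ˣ) hn0.ne'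
    (by rwa [Nat.card_eq_fintype_card, ZMod.card_units])
  refine ⟨g, fun h => hg ?_⟩
  rw [← ZMod.intCast_zmod_eq_zero_iff_dvd] at h
  push_cast at h
  rw [ZMod.natCast_zmod_val] at h
  exact Units.ext (by simpa using sub_eq_zero.1 h)

lemma dvd_sum_range_pow {n : ℕ} (hn0 : 0 < n) (hn : n < p - 1) :
    (p : ℤ) ∣ ∑ k ∈ Finset.range p, (k : ℤ) ^ n := by
  obtain ⟨g, hg⟩ := exists_unit_pow_ne_one hn0 hn
  have h := (dvd_pow_self (p : ℤ) two_ne_zero).trans (sq_dvd_pow_sub_one_mul_sum_pow_sub g n)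
  rw [dvd_sub_left ((dvd_mul_left _ _).mul_right _)] at h
  exact ((Nat.prime_iff_prime_int.1 Fact.out).dvd_or_dvd h).resolve_left hg

lemma dvd_pow_add_sub_pow (x : ℤ) {n : ℕ} (hn : 0 < n) :
    (p : ℤ) ∣ x ^ (n + (p - 1)) - x ^ n := by
  have hp : 0 < p := (Fact.out : p.Prime).pos
  rw [← ZMod.intCast_zmod_eq_zero_iff_dvd]
  push_cast
  rw [show n + (p - 1) = n - 1 + p by lia, pow_add, ZMod.pow_card, ← pow_succ,
    Nat.sub_add_cancel hn, sub_self]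

/-- Kummer's congruence for power sums. -/
lemma sq_dvd_mul_sum_range_pow_sub {n : ℕ} (hn1 : 1 < n) (hn : n < p - 1) :
    (p : ℤ) ^ 2 ∣ n * ∑ k ∈ Finset.range p, (k : ℤ) ^ (n + (p - 1)) -
      ((n + (p - 1) : ℕ) : ℤ) * ∑ k ∈ Finset.range p, (k : ℤ) ^ n := by
  have hpp : Prime (p : ℤ) := Nat.prime_iff_prime_int.1 Fact.out
  obtain ⟨g, hg⟩ := exists_unit_pow_ne_one (by lia) hn
  obtain ⟨u, hu⟩ := sq_dvd_pow_sub_one_mul_sum_pow_sub g n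
  obtain ⟨v, hv⟩ := sq_dvd_pow_sub_one_mul_sum_pow_sub g (n + (p - 1))
  obtain ⟨s, hs⟩ := dvd_sum_range_pow (by lia) hn
  obtain ⟨d, hd⟩ : (p : ℤ) ∣ ∑ k ∈ Finset.range p, (k : ℤ) ^ (n + (p - 1)) -
      ∑ k ∈ Finset.range p, (k : ℤ) ^ n := by
    rw [← Finset.sum_sub_distrib]
    exact Finset.dvd_sum fun k _ => dvd_pow_add_sub_pow _ (by lia)
  obtain ⟨e, he⟩ : (p : ℤ) ∣ ∑ x : ZMod p, (((g : ZMod p).val * x.val / p : ℕ) : ℤ) *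
        ((g * x : ZMod p).val : ℤ) ^ (n + (p - 1) - 1) -
      ∑ x : ZMod p, (((g : ZMod p).val * x.val / p : ℕ) : ℤ) *
        ((g * x : ZMod p).val : ℤ) ^ (n - 1) := by
    rw [← Finset.sum_sub_distrib]
    refine Finset.dvd_sum fun x _ => ?_
    rw [← mul_sub, show n + (p - 1) - 1 = n - 1 + (p - 1) by lia]
    exact (dvd_pow_add_sub_pow _ (by lia)).mul_left _
  obtain ⟨f, hf⟩ := dvd_pow_add_sub_pow (p := p) ((g : ZMod p).val : ℤ) (n := n) (by lia)
  refine hpp.pow_dvd_of_dvd_mul_left 2 hg ?_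
  generalize (∑ k ∈ Finset.range p, (k : ℤ) ^ (n + (p - 1))) = Sb at *
  generalize (∑ k ∈ Finset.range p, (k : ℤ) ^ n) = Sa at *
  generalize (∑ x : ZMod p, (((g : ZMod p).val * x.val / p : ℕ) : ℤ) *
        ((g * x : ZMod p).val : ℤ) ^ (n + (p - 1) - 1)) = Qb at *
  generalize (∑ x : ZMod p, (((g : ZMod p).val * x.val / p : ℕ) : ℤ) *
        ((g * x : ZMod p).val : ℤ) ^ (n - 1)) = Qa at *
  generalize ((g : ZMod p).val : ℤ) ^ (n + (p - 1)) = Gb at *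
  generalize ((g : ZMod p).val : ℤ) ^ n = Ga at *
  generalize ((n + (p - 1) : ℕ) : ℤ) = b at *
  refine ⟨n * v - b * u + n * b * e - n * f * (d + s), ?_⟩
  linear_combination n * hv - b * hu + n * b * p * he - n * Sb * hf -
    n * p * f * hd - n * p * f * hs

end PowerSums

lemma exists_inv_pow_eq {p : ℕ} (hp : p.Prime) {k n : ℕ} (hk0 : 0 < k) (hkp : k < p)
    (hn : n ≤ p - 1) :
    ∃ t ∈ Rat.primeToDen p hp, 1 / (k : ℚ) ^ n =
      2 * (k : ℚ) ^ (p - 1 - n) - (k : ℚ) ^ (p - 1 - n + (p - 1)) + p ^ 2 * t := by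
  have := Fact.mk hp
  obtain ⟨c, hc⟩ : (p : ℤ) ∣ (k : ℤ) ^ (p - 1) - 1 :=
    (Int.ModEq.pow_card_sub_one_eq_one hp (by
      rw [Int.isCoprime_iff_gcd_eq_one, Int.gcd_natCast_natCast]
      exact (Nat.coprime_of_lt_prime hk0.ne' hkp hp).symm)).symm.dvd
  have hcq : (k : ℚ) ^ (p - 1) - 1 = p * c := by exact_mod_cast hc
  have hk : (k : ℚ) ≠ 0 := by exact_mod_cast hk0.ne'
  refine ⟨c ^ 2 * ((k : ℚ)⁻¹) ^ n, mul_mem (pow_mem (intCast_mem _ _) _)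
    (pow_mem (Rat.primeToDen.inv_natCast_mem hk0 hkp) _), ?_⟩
  have hx : (k : ℚ) ^ (p - 1 - n) * (k : ℚ) ^ n = (k : ℚ) ^ (p - 1) := by
    rw [← pow_add, Nat.sub_add_cancel hn]
  rw [pow_add, inv_pow]
  field_simp
  generalize (k : ℚ) ^ (p - 1 - n) = A at *
  generalize (k : ℚ) ^ n = N at *
  generalize (k : ℚ) ^ (p - 1) = X at *
  linear_combination (X - 2) * hx + (X - 1 + p * c) * hcq

/-- Glaisher's congruence modulo `p²`: for odd `m > 1` and a prime `p > m`,
`((m−1)/m)·p·B_{p−m} ≡ ∑_{k=1}^{p−1} 1/k^{m−1} (mod p²)`. -/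
theorem glaisher_mod_p_squared (m : ℕ) (hodd : Odd m) (hm : 1 < m)
    (p : ℕ) (hp : p.Prime) (hmp : m < p) :
    ∃ z : ℚ, ¬ (p ∣ z.den) ∧
      ((((m : ℚ) - 1) / (m : ℚ)) * (p : ℚ) * bernoulli (p - m)) -
        (∑ k ∈ Finset.Icc 1 (p - 1), 1 / (k : ℚ) ^ (m - 1)) = (p : ℚ) ^ 2 * z := by
  have := Fact.mk hp
  have hpodd : Odd p := hp.odd_of_ne_two (by lia)
  have ha : 1 < p - m := by
    obtain ⟨i, hi⟩ := hodd
    obtain ⟨j, hj⟩ := hpodd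
    lia
  obtain ⟨w, hw, hS⟩ := Rat.primeToDen.exists_sum_range_pow_eq (p := p) (hp := hp)
    (n := p - m) (by lia)
  obtain ⟨c, hc⟩ := sq_dvd_mul_sum_range_pow_sub (p := p) ha (by lia)
  obtain ⟨s, hs⟩ := dvd_sum_range_pow (p := p) (n := p - m) (by lia) (by lia)
  obtain ⟨d, hd⟩ : (p : ℤ) ∣ ∑ k ∈ Finset.range p, (k : ℤ) ^ (p - m + (p - 1)) -
      ∑ k ∈ Finset.range p, (k : ℤ) ^ (p - m) := by
    rw [← Finset.sum_sub_distrib]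
    exact Finset.dvd_sum fun k _ => dvd_pow_add_sub_pow _ (by lia)
  have hIcc (f : ℕ → ℚ) (h0 : f 0 = 0) :
      ∑ k ∈ Finset.Icc 1 (p - 1), f k = ∑ k ∈ Finset.range p, f k := by
    rw [Finset.range_eq_Ico, Finset.sum_eq_sum_Ico_succ_bot hp.pos, h0, zero_add]
    exact Finset.sum_congr (by ext; simp; lia) fun _ _ => rfl
  choose! t ht htk using fun (k : ℕ) (hk : k ∈ Finset.Icc 1 (p - 1)) =>
    exists_inv_pow_eq hp (k := k) (n := m - 1) (by simp at hk; lia) (by simp at hk; lia) (by lia)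
  rw [Finset.sum_congr rfl htk, Finset.sum_add_distrib, Finset.sum_sub_distrib,
    ← Finset.mul_sum, ← Finset.mul_sum, show p - 1 - (m - 1) = p - m by lia,
    hIcc (fun k => (k : ℚ) ^ (p - m)) (by simp; lia),
    hIcc (fun k => (k : ℚ) ^ (p - m + (p - 1))) (by simp; lia)]
  have hT : ∑ k ∈ Finset.Icc 1 (p - 1), t k ∈ Rat.primeToDen p hp := sum_mem ht
  have hc' := congrArg (Int.cast : ℤ → ℚ) hc
  have hs' := congrArg (Int.cast : ℤ → ℚ) hs
  have hd' := congrArg (Int.cast : ℤ → ℚ) hd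
  push_cast [Nat.cast_sub hmp.le, Nat.cast_sub hp.one_le] at hc' hs' hd'
  have hm0 : (m : ℚ) ≠ 0 := by positivity
  generalize (∑ k ∈ Finset.range p, (k : ℚ) ^ (p - m + (p - 1))) = Sb at *
  generalize (∑ k ∈ Finset.range p, (k : ℚ) ^ (p - m)) = Sa at *
  generalize (∑ k ∈ Finset.Icc 1 (p - 1), t k) = T at *
  refine ⟨(-(m - 1) * w + d - s - c) * (m : ℚ)⁻¹ - T, sub_mem (mul_mem ?_
    (Rat.primeToDen.inv_natCast_mem (by lia) hmp)) hT, ?_⟩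
  · exact sub_mem (sub_mem (add_mem (mul_mem (neg_mem (sub_mem (natCast_mem _ _) (one_mem _))) hw)
      (intCast_mem _ _)) (intCast_mem _ _)) (intCast_mem _ _)
  · field_simp
    linear_combination -(m - 1) * hS - hc' + p * hd' - p * hs'
end
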